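/- If f(z) = ∑_{k≥1} a_{2k−1} z^{2k−1} is odd and univalent (injective) in the unit disk 𝔻 with a_1 = 1, then for every 0 ≤ r < 1 one has ∑_{k≥1} |a_{2k−1}| r^{2k−1} ≤ r/(1 − r²). -/

import Mathlib

section OddUniv
open Metric Set Complex Filter Topology

noncomputable def cf (g : ℂ → ℂ) (k : ℕ) : ℂ := iteratedDeriv k g 0 / (k.factorial : ℂ)

def PS (R : ℝ) (c : ℕ → ℂ) (g : ℂ → ℂ) : Prop :=
  ∀ z : ℂ, ‖z‖ < R → HasSum (fun k => c k * z ^ k) (g z)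

lemma ps_cf {R : ℝ} {g : ℂ → ℂ} (hg : DifferentiableOn ℂ g (ball 0 R)) : PS R (cf g) g := by
  intro z hz
  have := Complex.hasSum_taylorSeries_on_ball hg (z := z) (by simpa using hz)
  convert! this using 2 with k
  simp [cf]; ring

lemma PS.hasFPS {R : ℝ} (hR : 0 < R) {c : ℕ → ℂ} {g : ℂ → ℂ} (h : PS R c g) :
    HasFPowerSeriesOnBall g (FormalMultilinearSeries.ofScalars ℂ c) 0 (ENNReal.ofReal R) where
  r_le := by
    refine ENNReal.le_of_forall_nnreal_lt fun t ht => ?_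
    refine FormalMultilinearSeries.le_radius_of_tendsto _ (l := 0) ?_
    have ht' : (t : ℝ) < R := by
      rw [← ENNReal.ofReal_coe_nnreal] at ht
      exact (ENNReal.ofReal_lt_ofReal_iff hR).1 ht
    have := (h (t : ℝ) (by simpa using ht')).summable.tendsto_atTop_zero.norm
    simpa [FormalMultilinearSeries.ofScalars_norm] using this
  r_pos := by simpa using hR
  hasSum := by
    intro y hy
    have hy' : ‖y‖ < R := by
      rw [Metric.eball_ofReal] at hy; simpa using hy
    have := h y hy'
    simpa [FormalMultilinearSeries.ofScalars_apply_eq, mul_comm] using this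

lemma PS.diff {R : ℝ} (hR : 0 < R) {c : ℕ → ℂ} {g : ℂ → ℂ} (h : PS R c g) :
    DifferentiableOn ℂ g (ball 0 R) := by
  have := (h.hasFPS hR).differentiableOn
  rwa [Metric.eball_ofReal] at this

lemma PS.unique {R R' : ℝ} (hR : 0 < R) (hR' : 0 < R') {c c' : ℕ → ℂ} {g : ℂ → ℂ} (h : PS R c g) (h' : PS R' c' g) :
    c = c' := by
  have h1 := (h.hasFPS hR).hasFPowerSeriesAt.eq_formalMultilinearSeries
    (h'.hasFPS hR').hasFPowerSeriesAt
  exact FormalMultilinearSeries.ofScalars_series_injective ℂ ℂ h1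

lemma PS.eq_cf {R : ℝ} (hR : 0 < R) {c : ℕ → ℂ} {g : ℂ → ℂ} (h : PS R c g) : cf g = c :=
  (ps_cf (h.diff hR)).unique hR hR h

lemma PS.congr {R : ℝ} {c : ℕ → ℂ} {g g' : ℂ → ℂ} (h : PS R c g) (h' : ∀ z, ‖z‖ < R → g' z = g z) :
    PS R c g' := fun z hz => by rw [h' z hz]; exact h z hz

lemma cf_bound {R M : ℝ} (hR : 0 < R) {g : ℂ → ℂ} {R' : ℝ} (hRR : R < R')
    (hg : DifferentiableOn ℂ g (ball 0 R')) (hM : ∀ z, ‖z‖ ≤ R → ‖g z‖ ≤ M) (k : ℕ) :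
    ‖cf g k‖ ≤ M / R ^ k := by
  have := Complex.norm_iteratedDeriv_le_of_forall_mem_sphere_norm_le (c := 0) k hR
    (f := g) (C := M) (hg.diffContOnCl_ball (by
      intro z hz; simp at hz ⊢; linarith)) (by intro z hz; apply hM; simp at hz; linarith)
  rw [cf, norm_div, Complex.norm_natCast, div_le_iff₀ (by positivity)]
  calc _ ≤ _ := this
    _ = _ := by ring

lemma PS.bound {R M : ℝ} (hR : 0 < R) {g : ℂ → ℂ} {R' : ℝ} (hRR : R < R') {c : ℕ → ℂ}
    (hg : PS R' c g) (hM : ∀ z, ‖z‖ ≤ R → ‖g z‖ ≤ M) (k : ℕ) :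
    ‖c k‖ ≤ M / R ^ k := by
  rw [← hg.eq_cf (hR.trans hRR)]
  exact cf_bound hR hRR (hg.diff (hR.trans hRR)) hM k

lemma PS.zderiv {R : ℝ} (hR : 0 < R) {c : ℕ → ℂ} {g : ℂ → ℂ} (h : PS R c g) :
    PS R (fun k => k * c k) (fun z => z * deriv g z) := by
  have hd := h.diff hR
  have h1 := ps_cf (hd.deriv isOpen_ball)
  intro z hz
  have h2 := (h1 z hz).mul_left z
  rw [← hasSum_nat_add_iff' 1]
  simp only [Finset.sum_range_one, Nat.cast_zero, zero_mul, sub_zero]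
  convert! h2 using 2 with k
  rw [← h.eq_cf hR]
  simp only [cf, iteratedDeriv_succ', Nat.factorial_succ]
  have : (k.factorial : ℂ) ≠ 0 := by exact_mod_cast k.factorial_ne_zero
  have : ((k : ℂ) + 1) ≠ 0 := by exact_mod_cast k.succ_ne_zero
  push_cast
  field_simp
  ring

lemma exists_log {g : ℂ → ℂ} {R : ℝ} (hR : 0 < R) (hg : DifferentiableOn ℂ g (ball 0 R))
    (h0 : ∀ z ∈ ball (0 : ℂ) R, g z ≠ 0) :
    ∃ l : ℂ → ℂ, DifferentiableOn ℂ l (ball 0 R) ∧ ∀ z ∈ ball (0 : ℂ) R, exp (l z) = g z := by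
  have hd : DifferentiableOn ℂ (fun z => deriv g z / g z) (ball 0 R) :=
    (hg.deriv isOpen_ball).div hg h0
  obtain ⟨l, hl0, hl⟩ := hd.isExactOn_ball.with_val_at 0 (log (g 0))
  have hl' : DifferentiableOn ℂ l (ball 0 R) := fun z hz => (hl z hz).differentiableAt.differentiableWithinAt
  refine ⟨l, hl', ?_⟩
  have hc : ∀ z ∈ ball (0 : ℂ) R, HasDerivAt (fun z => exp (- l z) * g z) 0 z := by
    intro z hz
    have h1 := ((hl z hz).neg.cexp).mul ((hg.differentiableAt (isOpen_ball.mem_nhds hz)).hasDerivAt)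
    convert! h1 using 1
    have := h0 z hz
    field_simp
    ring
  have h00 : (0 : ℂ) ∈ ball (0 : ℂ) R := by simpa using hR
  intro z hz
  have := (convex_ball (0 : ℂ) R).is_const_of_fderivWithin_eq_zero (𝕜 := ℂ) (f := fun z => exp (- l z) * g z)
    (fun z hz => (hc z hz).differentiableAt.differentiableWithinAt)
    (fun z hz => by
      have := (hc z hz).hasFDerivAt.hasFDerivWithinAt (s := ball (0:ℂ) R)
      rw [this.fderivWithin (isOpen_ball.uniqueDiffWithinAt hz)]; ext; simp) hz h00
  simp only [hl0, Complex.exp_neg, Complex.exp_log (h0 0 h00)] at this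
  rw [inv_mul_cancel₀ (h0 0 h00)] at this
  have h3 := exp_ne_zero (l z)
  field_simp at this
  exact this.symm

lemma const_of_deriv {g : ℂ → ℂ} {R : ℝ} (hc : ∀ z ∈ ball (0 : ℂ) R, HasDerivAt g 0 z) :
    ∀ z ∈ ball (0 : ℂ) R, g z = g 0 := by
  intro z hz
  have hR : 0 < R := pos_of_mem_ball hz
  exact (convex_ball (0 : ℂ) R).is_const_of_fderivWithin_eq_zero (𝕜 := ℂ) (f := g)
    (fun z hz => (hc z hz).differentiableAt.differentiableWithinAt)
    (fun z hz => by
      have := (hc z hz).hasFDerivAt.hasFDerivWithinAt (s := ball (0:ℂ) R)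
      rw [this.fderivWithin (isOpen_ball.uniqueDiffWithinAt hz)]; ext; simp) hz (by simpa using hR)

/-- two logs of the same function have the same coefficients -/
lemma cf_eq_of_exp {g₁ g₂ : ℂ → ℂ} {R : ℝ} (hR : 0 < R) (h1 : DifferentiableOn ℂ g₁ (ball 0 R))
    (h2 : DifferentiableOn ℂ g₂ (ball 0 R)) {C : ℂ}
    (h : ∀ z ∈ ball (0 : ℂ) R, exp (g₁ z) = C * exp (g₂ z)) (k : ℕ) (hk : 1 ≤ k) :
    cf g₁ k = cf g₂ k := by
  have hd : ∀ z ∈ ball (0:ℂ) R, HasDerivAt (fun z => g₁ z - g₂ z) 0 z := by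
    intro z hz
    have e1 := (h1.differentiableAt (isOpen_ball.mem_nhds hz)).hasDerivAt
    have e2 := (h2.differentiableAt (isOpen_ball.mem_nhds hz)).hasDerivAt
    have e3 : HasDerivAt (fun z => exp (g₁ z)) (C * (exp (g₂ z) * deriv g₂ z)) z := by
      refine (e2.cexp.const_mul C).congr_of_eventuallyEq ?_
      filter_upwards [isOpen_ball.mem_nhds hz] with w hw using h w hw
    have e4 := e1.cexp.unique e3
    rw [← mul_assoc, ← h z hz] at e4
    have e5 := mul_left_cancel₀ (exp_ne_zero _) e4
    convert! e1.sub e2 using 1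
    rw [e5]; ring
  have hcst := const_of_deriv hd
  have p1 := ps_cf h1
  have p2 := ps_cf h2
  have p3 : PS R (fun k => cf g₂ k + if k = 0 then g₁ 0 - g₂ 0 else 0) g₁ := by
    intro z hz
    have := (p2 z hz).add (hasSum_ite_eq (0 : ℕ) (g₁ 0 - g₂ 0))
    rw [← hcst z (by simpa using hz)] at this
    convert! this using 1
    · ext j
      by_cases hj : j = 0 <;> simp [hj, hcst z (by simpa using hz)]
    · ring
  have := congrFun (p1.unique hR hR p3) k
  simpa [show k ≠ 0 by omega] using this


lemma inverse_exists {ψ : ℂ → ℂ} (hd : DifferentiableOn ℂ ψ (ball 0 1)) (hi : InjOn ψ (ball 0 1)) :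
    IsOpen (ψ '' ball 0 1) ∧ ∃ h : ℂ → ℂ, (∀ z ∈ ball (0:ℂ) 1, h (ψ z) = z) ∧
      DifferentiableOn ℂ h (ψ '' ball 0 1) := by
  have han : AnalyticOnNhd ℂ ψ (ball 0 1) := hd.analyticOnNhd isOpen_ball
  have hnc : ∀ z ∈ ball (0:ℂ) 1, ¬ (∀ᶠ w in 𝓝 z, ψ w = ψ z) := by
    intro z hz hev
    have h1 : ∀ᶠ w in 𝓝 z, w = z := by
      filter_upwards [hev, isOpen_ball.mem_nhds hz] with w h1 h2 using hi h2 hz h1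
    have h2 : ∀ᶠ w in 𝓝[≠] z, False := by
      filter_upwards [h1.filter_mono nhdsWithin_le_nhds, self_mem_nhdsWithin] with w a b using b a
    simpa using h2.exists
  have hmap : ∀ z ∈ ball (0:ℂ) 1, 𝓝 (ψ z) ≤ map ψ (𝓝 z) := fun z hz =>
    (han z hz).eventually_constant_or_nhds_le_map_nhds.resolve_left (hnc z hz)
  have hopen : IsOpen (ψ '' ball 0 1) := by
    rw [isOpen_iff_mem_nhds]
    rintro _ ⟨z, hz, rfl⟩
    exact hmap z hz (image_mem_map (isOpen_ball.mem_nhds hz))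
  refine ⟨hopen, Function.invFunOn ψ (ball 0 1), hi.leftInvOn_invFunOn, ?_⟩
  set h := Function.invFunOn ψ (ball 0 1)
  have hl : ∀ z ∈ ball (0:ℂ) 1, h (ψ z) = z := hi.leftInvOn_invFunOn
  have hr : ∀ w ∈ ψ '' ball 0 1, ψ (h w) = w := by
    rintro _ ⟨z, hz, rfl⟩; rw [hl z hz]
  have hcont : ∀ z ∈ ball (0:ℂ) 1, ContinuousAt h (ψ z) := by
    intro z hz
    rw [ContinuousAt, hl z hz]
    refine Tendsto.mono_left ?_ (hmap z hz)
    rw [tendsto_map'_iff]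
    refine tendsto_id.congr' ?_
    filter_upwards [isOpen_ball.mem_nhds hz] with w hw using (hl w hw).symm
  have hdiff : ∀ z ∈ ball (0:ℂ) 1, deriv ψ z ≠ 0 → DifferentiableAt ℂ h (ψ z) := by
    intro z hz hne
    refine (HasDerivAt.of_local_left_inverse (hcont z hz) (f := ψ) (f' := deriv ψ z) ?_ hne ?_).differentiableAt
    · rw [hl z hz]; exact (hd.differentiableAt (isOpen_ball.mem_nhds hz)).hasDerivAt
    · filter_upwards [hopen.mem_nhds ⟨z, hz, rfl⟩] with w hw using hr w hw
  rintro _ ⟨z, hz, rfl⟩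
  refine (analyticAt_of_differentiable_on_punctured_nhds_of_continuousAt ?_ (hcont z hz)).differentiableAt.differentiableWithinAt
  rcases (han z hz).deriv.eventually_eq_zero_or_eventually_ne_zero with h0 | h0
  · exfalso
    obtain ⟨ε, hε, hb⟩ := Metric.eventually_nhds_iff_ball.1 (h0.and (isOpen_ball.mem_nhds hz))
    apply hnc z hz
    filter_upwards [ball_mem_nhds z hε] with w hw
    refine (convex_ball z ε).is_const_of_fderivWithin_eq_zero (𝕜 := ℂ) (f := ψ)
      (fun y hy => ((hd.differentiableAt (isOpen_ball.mem_nhds (hb y hy).2))).differentiableWithinAt)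
      (fun y hy => ?_) hw (mem_ball_self hε)
    have := (hd.differentiableAt (isOpen_ball.mem_nhds (hb y hy).2)).hasDerivAt
    rw [(hb y hy).1] at this
    rw [(this.hasFDerivAt.hasFDerivWithinAt).fderivWithin (isOpen_ball.uniqueDiffWithinAt hy)]
    ext; simp
  · have ht : Tendsto h (𝓝[≠] (ψ z)) (𝓝[≠] z) := by
      refine tendsto_nhdsWithin_iff.2 ⟨?_, ?_⟩
      · have := (hcont z hz).tendsto.mono_left (nhdsWithin_le_nhds (s := {ψ z}ᶜ))
        rwa [hl z hz] at this
      · filter_upwards [self_mem_nhdsWithin, nhdsWithin_le_nhds (hopen.mem_nhds ⟨z, hz, rfl⟩)] with w h1 h2 h3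
        apply h1
        rw [mem_singleton_iff] at *
        rw [← h3, hr w h2]
    filter_upwards [ht.eventually h0, nhdsWithin_le_nhds (hopen.mem_nhds ⟨z, hz, rfl⟩)]
    rintro _ h1 ⟨y, hy, rfl⟩
    rw [hl y hy] at h1
    exact hdiff y hy h1

lemma circle_lemma {ψ : ℂ → ℂ} (hd : DifferentiableOn ℂ ψ (ball 0 1)) (hi : InjOn ψ (ball 0 1))
    {ρ : ℝ} (hs : sphere 0 ρ ⊆ ψ '' ball 0 1) : ball 0 ρ ⊆ ψ '' ball 0 1 := by
  intro a ha
  by_contra hna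
  obtain ⟨ho, h, hl, hh⟩ := inverse_exists hd hi
  obtain ⟨l, hld, hlog⟩ := exists_log one_pos (hd.sub_const a) (fun z hz h0 => hna ⟨z, hz, sub_eq_zero.1 h0⟩)
  have hmaps : MapsTo h (ψ '' ball 0 1) (ball 0 1) := by
    rintro _ ⟨z, hz, rfl⟩; rwa [hl z hz]
  have hM : DifferentiableOn ℂ (l ∘ h) (ψ '' ball 0 1) := hld.comp hh hmaps
  have hexp : ∀ w ∈ ψ '' ball 0 1, exp ((l ∘ h) w) = w - a := by
    rintro _ ⟨z, hz, rfl⟩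
    simp [hl z hz, hlog z hz]
  have hder : ∀ w ∈ ψ '' ball 0 1, HasDerivAt (l ∘ h) ((w - a)⁻¹) w := by
    intro w hw
    have e1 := (hM.differentiableAt (ho.mem_nhds hw)).hasDerivAt
    have e2 : HasDerivAt (fun w => exp ((l ∘ h) w)) 1 w := by
      refine ((hasDerivAt_id w).sub_const a).congr_of_eventuallyEq ?_
      filter_upwards [ho.mem_nhds hw] with y hy using hexp y hy
    have e3 := e1.cexp.unique e2
    rw [hexp w hw] at e3
    rwa [eq_inv_of_mul_eq_one_right e3] at e1
  have hρ : 0 ≤ ρ := (pos_of_mem_ball ha).le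
  have i1 := circleIntegral.integral_eq_zero_of_hasDerivWithinAt (c := (0:ℂ)) hρ
    (fun w hw => (hder w (hs hw)).hasDerivWithinAt)
  rw [circleIntegral.integral_sub_inv_of_mem_ball ha] at i1
  simp [Real.pi_ne_zero] at i1

structure Nice (ψ : ℂ → ℂ) : Prop where
  d : DifferentiableOn ℂ ψ (ball 0 1)
  i : InjOn ψ (ball 0 1)
  m : ∀ z ∈ ball (0:ℂ) 1, ψ z ∈ ball (0:ℂ) 1
  z : ψ 0 = 0

lemma Nice.hasDeriv {ψ : ℂ → ℂ} (h : Nice ψ) : HasDerivAt ψ (deriv ψ 0) 0 :=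
  (h.d.differentiableAt (isOpen_ball.mem_nhds (by simp))).hasDerivAt

lemma Nice.deriv_le {ψ : ℂ → ℂ} (h : Nice ψ) : ‖deriv ψ 0‖ ≤ 1 :=
  norm_deriv_le_one_of_mapsTo_ball h.d (fun z hz => by rw [h.z]; exact ball_subset_closedBall (h.m z hz)) one_pos

lemma Nice.norm_le {ψ : ℂ → ℂ} (h : Nice ψ) {z : ℂ} (hz : ‖z‖ < 1) : ‖ψ z‖ ≤ ‖z‖ :=
  norm_le_norm_of_mapsTo_ball h.d (fun z hz => ball_subset_closedBall (h.m z hz)) h.z hz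

lemma Nice.deriv_ge {ψ : ℂ → ℂ} (h : Nice ψ) {ρ : ℝ} (hρ : 0 < ρ) (hs : sphere 0 ρ ⊆ ψ '' ball 0 1) :
    ρ ≤ ‖deriv ψ 0‖ := by
  have hb := circle_lemma h.d h.i hs
  obtain ⟨ho, k, hl, hk⟩ := inverse_exists h.d h.i
  have h0 : k 0 = 0 := by have := hl 0 (by simp); rwa [h.z] at this
  have h1 : ‖deriv k 0‖ ≤ 1 / ρ := by
    refine norm_deriv_le_div_of_mapsTo_ball (hk.mono hb) ?_ hρ
    intro w hw
    obtain ⟨z, hz, rfl⟩ := hb hw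
    rw [hl z hz, h0]; exact ball_subset_closedBall hz
  have h2 : HasDerivAt k (deriv k 0) (ψ 0) := by
    rw [h.z]
    exact (hk.differentiableAt (ho.mem_nhds ⟨0, by simp, h.z⟩)).hasDerivAt
  have h3 := h2.comp 0 h.hasDeriv
  have h4 : HasDerivAt (k ∘ ψ) 1 0 := by
    refine (hasDerivAt_id (0:ℂ)).congr_of_eventuallyEq ?_
    filter_upwards [isOpen_ball.mem_nhds (show (0:ℂ) ∈ ball (0:ℂ) 1 by simp)] with z hz using hl z hz
  have h5 := h3.unique h4
  have h6 : ‖deriv k 0‖ * ‖deriv ψ 0‖ = 1 := by rw [← norm_mul, h5, norm_one]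
  rw [le_div_iff₀ hρ] at h1
  nlinarith [norm_nonneg (deriv ψ 0), norm_nonneg (deriv k 0)]

lemma mob_den {a : ℝ} (ha0 : 0 ≤ a) (ha : a < 1) {w : ℂ} (hw : ‖w‖ ≤ 1) : (1 - a * w : ℂ) ≠ 0 := by
  intro h
  have : (a * w : ℂ) = 1 := (sub_eq_zero.1 h).symm
  have h2 := congrArg norm this
  rw [norm_mul, norm_real, Real.norm_of_nonneg ha0, norm_one] at h2
  nlinarith [norm_nonneg w]

lemma mob_norm {a : ℝ} (ha0 : 0 ≤ a) (ha : a < 1) {w : ℂ} (hw : ‖w‖ < 1) :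
    ‖(a - w) / (1 - a * w)‖ < 1 := by
  rw [norm_div, div_lt_one (norm_pos_iff.2 (mob_den ha0 ha hw.le))]
  rw [← sq_lt_sq₀ (norm_nonneg _) (norm_nonneg _), Complex.sq_norm, Complex.sq_norm, normSq_apply, normSq_apply]
  have : ‖w‖ ^ 2 < 1 := by nlinarith [norm_nonneg w]
  rw [Complex.sq_norm, normSq_apply] at this
  simp
  nlinarith [mul_pos (sub_pos.2 this) (show 0 < 1 - a ^ 2 by nlinarith)]

lemma koebe_step {ψ : ℂ → ℂ} (h : Nice ψ) {b : ℝ} (hb0 : 0 < b) (hb1 : b < 1)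
    (hom : ∀ z ∈ ball (0:ℂ) 1, ψ z ≠ ((b ^ 2 : ℝ) : ℂ)) :
    ∃ ψ₁, Nice ψ₁ ∧ ∀ z ∈ ball (0:ℂ) 1, ψ z = ψ₁ z *
      ((((2 * b / (1 + b ^ 2) : ℝ) : ℂ) - ψ₁ z) / (1 - ((2 * b / (1 + b ^ 2) : ℝ) : ℂ) * ψ₁ z)) := by
  have ha0 : 0 ≤ b ^ 2 := by positivity
  have ha1 : b ^ 2 < 1 := by nlinarith
  have hm : ∀ z ∈ ball (0:ℂ) 1, ‖ψ z‖ < 1 := fun z hz => by simpa using h.m z hz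
  have hT : DifferentiableOn ℂ (fun z => (((b ^ 2 : ℝ) : ℂ) - ψ z) / (1 - ((b ^ 2 : ℝ) : ℂ) * ψ z)) (ball 0 1) := by
    refine (h.d.const_sub _).div ((h.d.const_mul _).const_sub _) fun z hz => mob_den ha0 ha1 (hm z hz).le
  obtain ⟨l, hld, hl⟩ := exists_log one_pos hT (fun z hz => div_ne_zero
    (sub_ne_zero.2 (hom z hz).symm) (mob_den ha0 ha1 (hm z hz).le))
  obtain ⟨χ, hχd, hχ, hχ0⟩ : ∃ χ : ℂ → ℂ, DifferentiableOn ℂ χ (ball 0 1) ∧ (∀ z ∈ ball (0:ℂ) 1, χ z ^ 2 =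
      (((b ^ 2 : ℝ) : ℂ) - ψ z) / (1 - ((b ^ 2 : ℝ) : ℂ) * ψ z)) ∧ χ 0 = b := by
    have e1 : DifferentiableOn ℂ (fun z => exp (l z / 2)) (ball 0 1) := (hld.div_const 2).cexp
    have e2 : ∀ z ∈ ball (0:ℂ) 1, exp (l z / 2) ^ 2 =
      (((b ^ 2 : ℝ) : ℂ) - ψ z) / (1 - ((b ^ 2 : ℝ) : ℂ) * ψ z) := by
      intro z hz
      rw [← hl z hz, ← Complex.exp_nat_mul]; congr 1; push_cast; ring
    have e3 := e2 0 (by simp)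
    rw [h.z] at e3
    have e4 : (exp (l 0 / 2) - b) * (exp (l 0 / 2) + b) = 0 := by
      simp at e3; linear_combination e3
    rcases mul_eq_zero.1 e4 with e5 | e5
    · exact ⟨_, e1, e2, sub_eq_zero.1 e5⟩
    · refine ⟨_, e1.neg, fun z hz => ?_, ?_⟩
      · have := e2 z hz
        simpa using this
      · simpa [neg_eq_iff_eq_neg] using eq_neg_of_add_eq_zero_left e5
  have hχm : ∀ z ∈ ball (0:ℂ) 1, ‖χ z‖ < 1 := by
    intro z hz
    have := mob_norm ha0 ha1 (hm z hz)
    rw [← hχ z hz, norm_pow] at this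
    nlinarith [norm_nonneg (χ z)]
  have hψ : ∀ z ∈ ball (0:ℂ) 1, ψ z = ((b:ℂ) ^ 2 - χ z ^ 2) / (1 - (b:ℂ) ^ 2 * χ z ^ 2) := by
    intro z hz
    have e1 := hχ z hz
    have e2 := mob_den ha0 ha1 (hm z hz).le
    have e3 := mob_den ha0 ha1 (w := χ z ^ 2) (by rw [norm_pow]; nlinarith [norm_nonneg (χ z), hχm z hz])
    push_cast at e1 e2 e3
    rw [eq_div_iff e2] at e1
    rw [eq_div_iff e3]
    linear_combination e1
  refine ⟨fun z => ((b:ℂ) - χ z) / (1 - b * χ z), ⟨?_, ?_, ?_, ?_⟩, ?_⟩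
  · exact (hχd.const_sub _).div ((hχd.const_mul _).const_sub _) fun z hz => mob_den hb0.le hb1 (hχm z hz).le
  · intro z hz w hw hzw
    apply h.i hz hw
    simp only at hzw
    rw [div_eq_div_iff (mob_den hb0.le hb1 (hχm z hz).le) (mob_den hb0.le hb1 (hχm w hw).le)] at hzw
    have hne : ((1:ℂ) - b ^ 2) ≠ 0 := by
      exact_mod_cast (sub_pos.2 ha1).ne'
    have : χ z = χ w := by
      apply mul_left_cancel₀ hne
      linear_combination -hzw
    rw [hψ z hz, hψ w hw, this]
  · intro z hz
    simpa using mob_norm hb0.le hb1 (hχm z hz)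
  · simp [hχ0]
  · intro z hz
    have d1 := mob_den hb0.le hb1 (hχm z hz).le
    have d2 := mob_den hb0.le hb1 (w := - χ z) (by rw [norm_neg]; exact (hχm z hz).le)
    have d3 := mob_den ha0 ha1 (w := χ z ^ 2) (by rw [norm_pow]; nlinarith [norm_nonneg (χ z), hχm z hz])
    have hc1 : 2 * b / (1 + b ^ 2) < 1 := by rw [div_lt_one (by positivity)]; nlinarith
    have d4 := mob_den (by positivity) hc1 (mob_norm hb0.le hb1 (hχm z hz)).le
    have d5 : ((1:ℂ) + b ^ 2) ≠ 0 := by exact_mod_cast (show (0:ℝ) < 1 + b ^ 2 by positivity).ne'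
    have hne : ((1:ℂ) - b ^ 2) ≠ 0 := by
      exact_mod_cast (sub_pos.2 ha1).ne'
    rw [hψ z hz]
    beta_reduce
    generalize χ z = x at *
    push_cast at *
    have d6 : (1 + (b:ℂ)^2) * (1 - b * x) - 2 * b * (b - x) ≠ 0 := by
      intro h0
      apply d4
      field_simp
      linear_combination h0
    have d7 : (1 : ℂ) + b * x ≠ 0 := by intro h0; apply d2; linear_combination h0
    have key : (2 * (b:ℂ) / (1 + b ^ 2) - (b - x) / (1 - b * x)) / (1 - 2 * b / (1 + b ^ 2) * ((b - x) / (1 - b * x)))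
        = (2 * b * (1 - b * x) - (1 + b ^ 2) * (b - x)) / ((1 + (b:ℂ)^2) * (1 - b * x) - 2 * b * (b - x)) := by
      rw [div_eq_div_iff d4 d6]
      field_simp
      try ring
    rw [key, div_mul_div_comm, div_eq_div_iff d3 (mul_ne_zero d1 d6)]
    ring


noncomputable def NN (n : ℕ) (c : ℕ → ℂ) (r : ℝ) : ℝ :=
  ∑ k ∈ Finset.range n, ((k:ℝ) + 1) * ‖c (k + 1)‖ ^ 2 * r ^ (k + 1)

noncomputable def vv (c : ℕ → ℂ) (k : ℕ) : ℂ := 1 + ∑ j ∈ Finset.range k, ((j:ℂ) + 1) * c (j + 1)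

lemma vv_succ (c : ℕ → ℂ) (k : ℕ) : vv c (k + 1) = vv c k + ((k:ℂ) + 1) * c (k + 1) := by
  simp [vv, Finset.sum_range_succ]; ring

lemma tele (v : ℕ → ℂ) (h0 : v 0 = 1) (n : ℕ) {r : ℝ} (hr0 : 0 ≤ r) (hr : r < 1) :
    -(4 * r / (1 + r)) ≤ ∑ k ∈ Finset.range n,
      (2 * (‖v (k+1)‖ ^ 2 - ‖v k‖ ^ 2) - (1 - r) / (1 + r) * ‖v (k+1) - v k‖ ^ 2) * r ^ (k + 1) := by
  suffices h : 4 * r / (1 + r) * (‖v n‖ ^ 2 * r ^ n) - 4 * r / (1 + r) ≤ ∑ k ∈ Finset.range n,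
      (2 * (‖v (k+1)‖ ^ 2 - ‖v k‖ ^ 2) - (1 - r) / (1 + r) * ‖v (k+1) - v k‖ ^ 2) * r ^ (k + 1) by
    have : 0 ≤ 4 * r / (1 + r) * (‖v n‖ ^ 2 * r ^ n) := by positivity
    linarith
  induction n with
  | zero => simp [h0]
  | succ n ih =>
    rw [Finset.sum_range_succ]
    have h1 : ‖v (n+1) - v n‖ ^ 2 ≤ 2 * (‖v (n+1)‖ ^ 2 + ‖v n‖ ^ 2) := by
      have := norm_sub_le (v (n+1)) (v n)
      nlinarith [norm_nonneg (v (n+1) - v n), sq_nonneg (‖v (n+1)‖ - ‖v n‖)]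
    have h2 : 4 / (1 + r) * (r * ‖v (n+1)‖ ^ 2 - ‖v n‖ ^ 2) ≤
        2 * (‖v (n+1)‖ ^ 2 - ‖v n‖ ^ 2) - (1 - r) / (1 + r) * ‖v (n+1) - v n‖ ^ 2 := by
      have : (1 - r) / (1 + r) * ‖v (n+1) - v n‖ ^ 2 ≤ (1 - r) / (1 + r) * (2 * (‖v (n+1)‖ ^ 2 + ‖v n‖ ^ 2)) :=
        mul_le_mul_of_nonneg_left h1 (div_nonneg (by linarith) (by linarith))
      refine le_trans (le_of_eq ?_) (sub_le_sub_left this _)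
      field_simp
      ring
    have h3 := mul_le_mul_of_nonneg_right h2 (pow_nonneg hr0 (n+1))
    refine le_trans (le_of_eq ?_) (add_le_add ih h3)
    field_simp
    ring

lemma step_alg (n : ℕ) (B E D : ℝ) (hB : 0 ≤ B) (hE : 0 ≤ E) (hD : 0 ≤ D) : ∃ C, 0 ≤ C ∧ ∀ (c c' : ℕ → ℂ) (ε : ℝ), 0 < ε → ε ≤ 1 →
    (∀ k < n, ‖c (k+1)‖ ≤ B) →
    (∀ k < n, ‖vv c (k+1) + vv c k‖ ≤ D) →
    (∀ k < n, ‖c' (k+1) - (c (k+1) - ε * (vv c (k+1) + vv c k))‖ ≤ E * ε ^ 2) →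
    ∀ r : ℝ, 0 ≤ r → r < 1 → ∃ w, 0 ≤ w ∧ w < 1 ∧
      NN n c' r + 4 * Real.log (1 - r) ≤ NN n c w + 4 * Real.log (1 - w) + C * ε ^ 2 := by
  refine ⟨(2 * B * E + (D + E)^2) * (∑ k ∈ Finset.range n, ((k:ℝ) + 1)) + 4, by positivity, ?_⟩
  intro c c' ε hε hε1 hcB hcD hcE r hr0 hr
  set κ := (1 - r) / (1 + r) with hκ
  have hκ0 : 0 ≤ κ := div_nonneg (by linarith) (by linarith)
  have hκ1 : κ ≤ 1 := by rw [hκ, div_le_one (by linarith)]; linarith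
  have hεκ : 0 ≤ ε * κ := by positivity
  have hεκ1 : ε * κ ≤ 1 := by nlinarith
  refine ⟨r * (1 - ε * κ), mul_nonneg hr0 (by linarith), by nlinarith, ?_⟩
  set w := r * (1 - ε * κ) with hw
  set K := 2 * B * E + (D + E)^2 with hK
  -- termwise
  have ht : ∀ k ∈ Finset.range n, ((k:ℝ) + 1) * ‖c' (k + 1)‖ ^ 2 * r ^ (k + 1) ≤
      ((k:ℝ) + 1) * ‖c (k + 1)‖ ^ 2 * w ^ (k + 1) - ε * ((2 * (‖vv c (k+1)‖ ^ 2 - ‖vv c k‖ ^ 2) - (1 - r) / (1 + r) * ‖vv c (k+1) - vv c k‖ ^ 2) * r ^ (k + 1))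
       + K * ε ^ 2 * ((k:ℝ) + 1) := by
    intro k hk
    have hk := Finset.mem_range.1 hk
    have b1 := hcB k hk
    have b2 := hcD k hk
    have b3 := hcE k hk
    have hv := vv_succ c k
    set x := c (k+1)
    set y := c' (k+1)
    set a := vv c (k+1)
    set b := vv c k
    -- y = x + u
    obtain ⟨e, he⟩ : ∃ e, e = y - (x - ε * (a + b)) := ⟨_, rfl⟩
    rw [← he] at b3
    have hy : y = x + (e - ε * (a + b)) := by rw [he]; ring
    have hu : ‖e - ε * (a + b)‖ ≤ ε * (D + E) := by
      refine (norm_sub_le _ _).trans ?_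
      rw [norm_mul, norm_real, Real.norm_of_nonneg hε.le]
      have i1 : ε * ‖a + b‖ ≤ ε * D := by gcongr
      have i2 : E * ε ^ 2 ≤ E * ε := by
        gcongr; nlinarith
      linarith
    have hsq : ‖y‖ ^ 2 ≤ ‖x‖ ^ 2 - 2 * ε * (x.re * (a+b).re + x.im * (a+b).im) + K * ε ^ 2 := by
      have e1 : ‖y‖ ^ 2 = ‖x‖ ^ 2 - 2 * ε * (x.re * (a+b).re + x.im * (a+b).im) + 2 * ((starRingEnd ℂ) x * e).re + ‖e - ε * (a + b)‖ ^ 2 := by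
        rw [hy]
        simp only [Complex.sq_norm, normSq_apply]
        simp
        ring
      have e2 : ((starRingEnd ℂ) x * e).re ≤ B * (E * ε ^ 2) := by
        refine (re_le_norm _).trans ?_
        rw [norm_mul, Complex.norm_conj]
        gcongr
      have e3 : ‖e - ε * (a + b)‖ ^ 2 ≤ (ε * (D + E)) ^ 2 := by gcongr
      rw [e1, hK]; nlinarith
    have hk1 : (0:ℝ) < (k:ℝ) + 1 := by positivity
    have hre : ((k:ℝ) + 1) * (x.re * (a+b).re + x.im * (a+b).im) = ‖a‖ ^ 2 - ‖b‖ ^ 2 := by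
      have hr : a.re = b.re + ((k:ℝ)+1) * x.re := by rw [hv]; simp
      have hi : a.im = b.im + ((k:ℝ)+1) * x.im := by rw [hv]; simp
      simp only [Complex.sq_norm, normSq_apply, add_re, add_im]
      rw [hr, hi]; ring
    have hab : ‖a - b‖ ^ 2 = ((k:ℝ)+1)^2 * ‖x‖ ^ 2 := by
      rw [hv, add_sub_cancel_left, norm_mul, mul_pow]
      congr 2
      have : ((k:ℂ) + 1) = (((k:ℝ)+1 : ℝ) : ℂ) := by push_cast; rfl
      rw [this, norm_real, Real.norm_of_nonneg hk1.le]
    have hbern : r ^ (k+1) * (1 - ((k:ℝ)+1) * (ε * κ)) ≤ w ^ (k+1) := by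
      rw [hw, mul_pow]
      gcongr
      have := one_add_mul_le_pow (a := -(ε * κ)) (by linarith) (k+1)
      push_cast at this
      calc _ = _ := by ring
        _ ≤ _ := this
        _ = _ := by ring
    have hrp : r ^ (k+1) ≤ 1 := pow_le_one₀ hr0 hr.le
    have hrp0 : 0 ≤ r ^ (k+1) := pow_nonneg hr0 _
    have hK0 : 0 ≤ K := by positivity
    calc ((k:ℝ) + 1) * ‖y‖ ^ 2 * r ^ (k + 1)
        ≤ ((k:ℝ) + 1) * (‖x‖ ^ 2 - 2 * ε * (x.re * (a+b).re + x.im * (a+b).im) + K * ε ^ 2) * r ^ (k + 1) := by gcongr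
      _ = ((k:ℝ) + 1) * ‖x‖ ^ 2 * (r ^ (k+1) * (1 - ((k:ℝ)+1) * (ε * κ))) + ε * κ * (((k:ℝ)+1)^2 * ‖x‖ ^ 2) * r ^ (k+1) - 2 * ε * (((k:ℝ) + 1) * (x.re * (a+b).re + x.im * (a+b).im)) * r ^ (k+1) + K * ε ^ 2 * ((k:ℝ) + 1) * r ^ (k+1) := by ring
      _ ≤ ((k:ℝ) + 1) * ‖x‖ ^ 2 * w ^ (k+1) + ε * κ * (((k:ℝ)+1)^2 * ‖x‖ ^ 2) * r ^ (k+1) - 2 * ε * (((k:ℝ) + 1) * (x.re * (a+b).re + x.im * (a+b).im)) * r ^ (k+1) + K * ε ^ 2 * ((k:ℝ) + 1) * 1 := by gcongr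
      _ = _ := by rw [hre, ← hab]; ring
  have hsum := Finset.sum_le_sum ht
  rw [Finset.sum_add_distrib, Finset.sum_sub_distrib, ← Finset.mul_sum, ← Finset.mul_sum] at hsum
  have htele := mul_le_mul_of_nonneg_left (tele (vv c) (by simp [vv]) n hr0 hr) hε.le
  have hlog : Real.log (1 - r) ≤ Real.log (1 - w) - ε * (r / (1 + r)) + ε ^ 2 := by
    have e0 : 1 - w = (1 - r) * (1 + ε * (r / (1+r))) := by
      rw [hw, hκ]; field_simp; ring
    set x := ε * (r / (1+r)) with hx
    have hx0 : 0 ≤ x := by positivity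
    have hx1 : x ≤ ε := by
      rw [hx]; exact mul_le_of_le_one_right hε.le (by rw [div_le_one (by linarith)]; linarith)
    rw [e0, Real.log_mul (by linarith) (by linarith)]
    have : x - x ^ 2 ≤ Real.log (1 + x) := by
      have := Real.one_sub_inv_le_log_of_pos (show 0 < 1 + x by linarith)
      refine le_trans ?_ this
      have : (1 + x)⁻¹ ≤ 1 - x + x ^ 2 := by
        rw [inv_le_iff_one_le_mul₀ (by linarith)]
        nlinarith [pow_nonneg hx0 3]
      linarith
    nlinarith
  unfold NN
  have : ε * -(4 * r / (1 + r)) = -(4 * (ε * (r/(1+r)))) := by ring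
  rw [this] at htele
  linarith


lemma bc_coef {g : ℂ → ℂ} {T : ℝ} (hT : 0 ≤ T) (hg : DifferentiableOn ℂ g (ball 0 (1/2)))
    (hre : ∀ z ∈ ball (0:ℂ) (1/2), (g z).re ≤ 0) (h0 : -T ≤ (g 0).re) (k : ℕ) (hk : 1 ≤ k) :
    ‖cf g k‖ ≤ 6 * (T + 1) * (8/3) ^ k := by
  have hd : DifferentiableOn ℂ (fun z => g z - g 0) (ball 0 (1/2)) := hg.sub_const _
  have h1 : cf g k = cf (fun z => g z - g 0) k :=
    cf_eq_of_exp (C := exp (g 0)) (by norm_num) hg hd (fun z _ => by rw [← exp_add]; ring_nf) k hk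
  rw [h1]
  have := cf_bound (R := 3/8) (M := 6 * (T+1)) (R' := 1/2) (by norm_num) (by norm_num) hd ?_ k
  · refine this.trans (le_of_eq ?_)
    rw [div_eq_mul_inv, ← inv_pow]; norm_num
  · intro z hz
    have hz' : z ∈ ball (0:ℂ) (1/2) := by simp; linarith
    have := borelCaratheodory_zero (M := T + 1) (R := 1/2) (f := fun z => g z - g 0) (by linarith) hd
      (fun w hw => by have := hre w hw; simp; linarith) (by norm_num) hz' (by simp)
    refine this.trans ?_
    rw [div_le_iff₀ (by linarith)]
    nlinarith

lemma pow_taylor {q : ℂ} (hq : ‖q‖ ≤ 1) (j : ℕ) : ‖q ^ j - 1 - j * (q - 1)‖ ≤ (j:ℝ) ^ 2 * ‖q - 1‖ ^ 2 := by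
  induction j with
  | zero => simp
  | succ j ih =>
    have e : q ^ (j+1) - 1 - ((j+1 : ℕ):ℂ) * (q - 1) = q * (q ^ j - 1 - j * (q - 1)) + j * (q-1) ^ 2 := by
      push_cast; ring
    rw [e]
    refine (norm_add_le _ _).trans ?_
    rw [norm_mul, norm_mul, norm_pow, norm_natCast]
    push_cast
    have : ‖q‖ * ‖q ^ j - 1 - j * (q - 1)‖ ≤ 1 * ((j:ℝ) ^ 2 * ‖q - 1‖ ^ 2) := by gcongr
    have h2 : 0 ≤ ‖q-1‖ ^ 2 := by positivity
    have h3 : 0 ≤ (j:ℝ) := by positivity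
    nlinarith [mul_nonneg h3 h2]

noncomputable def SS : ℝ := ∑' j : ℕ, (j:ℝ) ^ 2 * (2/3) ^ j

lemma SS_summable : Summable (fun j : ℕ => (j:ℝ) ^ 2 * (2/3) ^ j) :=
  summable_pow_mul_geometric_of_norm_lt_one 2 (by norm_num)

lemma SS_nonneg : 0 ≤ SS := tsum_nonneg fun j => by positivity

lemma comp_taylor {g : ℂ → ℂ} {c : ℕ → ℂ} {A : ℝ} (hA : 0 ≤ A) (h : PS (1/2) c g)
    (hc : ∀ k, 1 ≤ k → ‖c k‖ ≤ A * (8/3) ^ k) {z q : ℂ} (hz : ‖z‖ ≤ 1/4) (hq : ‖q‖ ≤ 1) :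
    ‖g (z * q) - g z - z * deriv g z * (q - 1)‖ ≤ A * SS * ‖q - 1‖ ^ 2 := by
  have hz' : ‖z‖ < 1/2 := by linarith
  have hzq : ‖z * q‖ < 1/2 := by rw [norm_mul]; nlinarith [norm_nonneg z, norm_nonneg q]
  have s1 := h _ hzq
  have s2 := h _ hz'
  have s3 := ((h.zderiv (by norm_num)) z hz').mul_right (q - 1)
  have s := (s1.sub s2).sub s3
  refine (s.norm_le_of_bounded ((SS_summable.hasSum.mul_left A).mul_right (‖q-1‖^2)) ?_)
  intro j
  have e : c j * (z * q) ^ j - c j * z ^ j - j * c j * z ^ j * (q - 1) = c j * z ^ j * (q ^ j - 1 - j * (q - 1)) := by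
    rw [mul_pow]; ring
  rw [e, norm_mul, norm_mul, norm_pow]
  rcases Nat.eq_zero_or_pos j with rfl | hj
  · simp
  calc ‖c j‖ * ‖z‖ ^ j * ‖q ^ j - 1 - j * (q - 1)‖
      ≤ (A * (8/3) ^ j) * (1/4) ^ j * ((j:ℝ) ^ 2 * ‖q - 1‖ ^ 2) := by
        gcongr
        · exact hc j hj
        · exact pow_taylor hq j
    _ = _ := by
        have : (2/3 : ℝ) ^ j = (8/3) ^ j * (1/4) ^ j := by rw [← mul_pow]; norm_num
        rw [this]; ring

lemma zderiv_bound {g : ℂ → ℂ} {c : ℕ → ℂ} {A : ℝ} (hA : 0 ≤ A) (h : PS (1/2) c g)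
    (hc : ∀ k, 1 ≤ k → ‖c k‖ ≤ A * (8/3) ^ k) {z : ℂ} (hz : ‖z‖ ≤ 1/4) :
    ‖z * deriv g z‖ ≤ A * SS := by
  have hz' : ‖z‖ < 1/2 := by linarith
  have s := ((h.zderiv (by norm_num)) z hz')
  refine (s.norm_le_of_bounded ((SS_summable.hasSum.mul_left A)) ?_)
  intro j
  rcases Nat.eq_zero_or_pos j with rfl | hj
  · simp
  have hj1 : (1:ℝ) ≤ j := by exact_mod_cast hj
  rw [norm_mul, norm_mul, norm_pow, norm_natCast]
  calc (j:ℝ) * ‖c j‖ * ‖z‖ ^ j 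
      ≤ (j:ℝ)^2 * (A * (8/3) ^ j) * (1/4) ^ j := by
        gcongr
        · nlinarith
        · exact hc j hj
    _ = _ := by
        have : (2/3 : ℝ) ^ j = (8/3) ^ j * (1/4) ^ j := by rw [← mul_pow]; norm_num
        rw [this]; ring

lemma PS.mulz {R : ℝ} {c : ℕ → ℂ} {g : ℂ → ℂ} (h : PS R c g) :
    PS R (fun k => if k = 0 then 0 else c (k-1)) (fun z => z * g z) := by
  intro z hz
  rw [← hasSum_nat_add_iff' 1]
  simp only [Finset.sum_range_one]
  have e : (fun n => (if n + 1 = 0 then 0 else c (n + 1 - 1)) * z ^ (n + 1)) = fun k => z * (c k * z ^ k) := by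
    ext k; simp; ring
  rw [e]
  simpa using (h z hz).mul_left z

lemma PS.add {R : ℝ} {c c' : ℕ → ℂ} {g g' : ℂ → ℂ} (h : PS R c g) (h' : PS R c' g') :
    PS R (fun k => c k + c' k) (fun z => g z + g' z) := by
  intro z hz
  convert! (h z hz).add (h' z hz) using 2 with k
  ring

lemma PS.smul {R : ℝ} {c : ℕ → ℂ} {g : ℂ → ℂ} (h : PS R c g) (a : ℂ) :
    PS R (fun k => a * c k) (fun z => a * g z) := by
  intro z hz
  convert! (h z hz).mul_left a using 2 with k
  ring

lemma PS.addc {R : ℝ} {c : ℕ → ℂ} {g : ℂ → ℂ} (h : PS R c g) (a : ℂ) :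
    PS R (fun k => c k + if k = 0 then a else 0) (fun z => g z + a) := by
  intro z hz
  convert! (h z hz).add (hasSum_ite_eq (0 : ℕ) a) using 2 with k
  by_cases hk : k = 0 <;> simp [hk]

lemma P_coef {g : ℂ → ℂ} {c : ℕ → ℂ} (h : PS (1/2) c g) :
    DifferentiableOn ℂ (fun z => (1 + z) / (1 - z) * (1 + z * deriv g z)) (ball 0 (1/2)) ∧
    ∀ k, cf (fun z => (1 + z) / (1 - z) * (1 + z * deriv g z)) (k+1) = vv c (k+1) + vv c k := by
  set P := fun z => (1 + z) / (1 - z) * (1 + z * deriv g z) with hP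
  have hne : ∀ z : ℂ, ‖z‖ < 1/2 → (1 - z) ≠ 0 := by
    intro z hz h0
    have : z = 1 := (sub_eq_zero.1 h0).symm
    rw [this] at hz; norm_num at hz
  have hgd := h.diff (by norm_num)
  have hd : DifferentiableOn ℂ P (ball 0 (1/2)) := by
    refine DifferentiableOn.mul (DifferentiableOn.div (by fun_prop) (by fun_prop) fun z hz => hne z (by simpa using hz)) ?_
    exact (differentiableOn_id.mul (hgd.deriv isOpen_ball)).const_add 1
  refine ⟨hd, ?_⟩
  have p1 := ps_cf hd
  have pl := p1.add (p1.mulz.smul (-1))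
  have u := (h.zderiv (by norm_num)).addc 1
  have pr := u.add u.mulz
  have pr' := pr.congr (g' := fun z => P z + -1 * (z * P z)) (fun z hz => by
    have := hne z hz
    simp only [hP]; field_simp; ring)
  have e := pl.unique (by norm_num) (by norm_num) pr'
  intro k
  induction k with
  | zero =>
    have e0 := congrFun e 0
    have e1 := congrFun e 1
    simp at e0 e1
    simp [vv]
    linear_combination e0 + e1
  | succ k ih =>
    have e1 := congrFun e (k+1+1)
    simp at e1
    have i1 := vv_succ c (k+1)
    have i2 := vv_succ c k
    push_cast at i1 i2 e1
    linear_combination e1 + ih - i1 - i2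


noncomputable def qq (c : ℝ) (z : ℂ) : ℂ := (c - z) / (1 - c * z)

lemma qq_den {c : ℝ} (h0 : 0 ≤ c) (h1 : c < 1) {z : ℂ} : 1 - ‖z‖ ≤ ‖1 - c * z‖ := by
  have := norm_sub_norm_le (1:ℂ) (c * z)
  rw [norm_mul, norm_real, Real.norm_of_nonneg h0, norm_one] at this
  nlinarith [norm_nonneg z]

lemma qq_sub {c : ℝ} (h0 : 0 ≤ c) (h1 : c < 1) {z : ℂ} (hz : ‖z‖ < 1) :
    qq c z - 1 = -((1 - c : ℝ) : ℂ) * (1 + z) / (1 - c * z) := by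
  have := mob_den h0 h1 hz.le
  unfold qq
  field_simp
  push_cast; ring

lemma qq_sub_norm {c : ℝ} (h0 : 0 ≤ c) (h1 : c < 1) {z : ℂ} (hz : ‖z‖ < 1) :
    ‖qq c z - 1‖ ≤ (1 - c) * ((1 + ‖z‖) / (1 - ‖z‖)) := by
  rw [qq_sub h0 h1 hz, norm_div, norm_mul, norm_neg, norm_real, Real.norm_of_nonneg (by linarith), mul_div_assoc]
  refine mul_le_mul_of_nonneg_left ?_ (by linarith)
  exact div_le_div₀ (by positivity) (by simpa using norm_add_le (1:ℂ) z) (by linarith) (qq_den h0 h1)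

lemma qq_lt {ε : ℝ} (hε : 0 < ε) (hε1 : ε ≤ 1/8) {z : ℂ} (hz : ‖z‖ < 1/2) : ‖qq (1 - ε) z - 1‖ < 1 := by
  refine (qq_sub_norm (by linarith) (by linarith) (by linarith)).trans_lt ?_
  have : (1 + ‖z‖) / (1 - ‖z‖) ≤ 3 := by rw [div_le_iff₀ (by linarith)]; linarith
  nlinarith

lemma qq_slit {ε : ℝ} (hε : 0 < ε) (hε1 : ε ≤ 1/8) {z : ℂ} (hz : ‖z‖ < 1/2) : qq (1 - ε) z ∈ slitPlane := by
  have := mem_slitPlane_of_norm_lt_one (qq_lt hε hε1 hz)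
  simpa using this

lemma qq_diff {c : ℝ} (h0 : 0 ≤ c) (h1 : c < 1) : DifferentiableOn ℂ (qq c) (ball 0 1) := by
  unfold qq
  exact (differentiableOn_id.const_sub _).div ((differentiableOn_id.const_mul _).const_sub _)
    fun z hz => mob_den h0 h1 (by simp at hz; exact hz.le)

lemma qq_norm {c : ℝ} (h0 : 0 ≤ c) (h1 : c < 1) {z : ℂ} (hz : ‖z‖ < 1) : ‖qq c z‖ < 1 := mob_norm h0 h1 hz

noncomputable def gt' (g : ℂ → ℂ) (ε : ℝ) (z : ℂ) : ℂ := g (z * qq (1 - ε) z) + log (qq (1 - ε) z)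

lemma gt_diff {g : ℂ → ℂ} {ε : ℝ} (hε : 0 < ε) (hε1 : ε ≤ 1/8) (hg : DifferentiableOn ℂ g (ball 0 (1/2))) :
    DifferentiableOn ℂ (gt' g ε) (ball 0 (1/2)) := by
  have hq : DifferentiableOn ℂ (qq (1 - ε)) (ball 0 (1/2)) :=
    (qq_diff (by linarith) (by linarith)).mono (ball_subset_ball (by norm_num))
  refine DifferentiableOn.add ?_ (hq.clog fun z hz => qq_slit hε hε1 (by simpa using hz))
  refine hg.comp (differentiableOn_id.mul hq) ?_
  intro z hz
  simp at hz ⊢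
  have := qq_norm (c := 1 - ε) (by linarith) (by linarith) (z := z) (by linarith)
  nlinarith [norm_nonneg z, norm_nonneg (qq (1-ε) z)]

lemma gt_re {g : ℂ → ℂ} {ε : ℝ} (hε : 0 < ε) (hε1 : ε ≤ 1/8)
    (hre : ∀ z ∈ ball (0:ℂ) (1/2), (g z).re ≤ 0) : ∀ z ∈ ball (0:ℂ) (1/2), (gt' g ε z).re ≤ 0 := by
  intro z hz
  simp at hz
  have := qq_norm (c := 1 - ε) (by linarith) (by linarith) (z := z) (by linarith)
  have h1 := hre (z * qq (1-ε) z) (by simp; nlinarith [norm_nonneg z, norm_nonneg (qq (1-ε) z)])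
  have h2 := Real.log_nonpos (norm_nonneg _) this.le
  rw [gt', add_re, log_re]
  linarith

lemma gt_zero {g : ℂ → ℂ} {ε : ℝ} (hε : 0 < ε) (hε1 : ε ≤ 1/8) : (gt' g ε 0).re = (g 0).re + Real.log (1 - ε) := by
  rw [gt', add_re, log_re]
  simp only [qq, zero_mul, mul_zero, sub_zero, div_one, norm_real, Real.norm_of_nonneg (show 0 ≤ 1 - ε by linarith)]

lemma step_lemma (n : ℕ) (T : ℝ) (hT : 0 ≤ T) : ∃ C, 0 ≤ C ∧ ∀ (g : ℂ → ℂ) (ε : ℝ),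
    DifferentiableOn ℂ g (ball 0 (1/2)) → (∀ z ∈ ball (0:ℂ) (1/2), (g z).re ≤ 0) → -T ≤ (g 0).re →
    0 < ε → ε ≤ 1/8 → ∀ r : ℝ, 0 ≤ r → r < 1 → ∃ w, 0 ≤ w ∧ w < 1 ∧
      NN n (cf (gt' g ε)) r + 4 * Real.log (1 - r) ≤ NN n (cf g) w + 4 * Real.log (1 - w) + C * ε ^ 2 := by
  set A := 6 * (T + 1) with hA
  have hA0 : 0 ≤ A := by positivity
  have hS := SS_nonneg
  obtain ⟨C, hC0, hC⟩ := step_alg n (A * (8/3) ^ n) ((5 * (A * SS) + 5) * 4 ^ n) (2 * (1 + A * SS) * 4 ^ n)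
    (by positivity) (by positivity) (by positivity)
  refine ⟨C, hC0, ?_⟩
  intro g ε hg hre h0 hε hε1
  have hps := ps_cf hg
  have hcA : ∀ k, 1 ≤ k → ‖cf g k‖ ≤ A * (8/3) ^ k := bc_coef hT hg hre h0
  obtain ⟨hPd, hPc⟩ := P_coef hps
  set P := fun z => (1 + z) / (1 - z) * (1 + z * deriv g z) with hP
  apply hC _ _ ε hε (by linarith)
  · intro k hk
    refine (hcA _ (by omega)).trans ?_
    gcongr
    · norm_num
    · omega
  · intro k hk
    rw [← hPc]
    have := cf_bound (R := 1/4) (M := 2 * (1 + A * SS)) (by norm_num) (by norm_num) hPd ?_ (k+1)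
    · refine this.trans ?_
      rw [div_eq_mul_inv, ← inv_pow]
      norm_num
      gcongr
      · norm_num
      · omega
    · intro z hz
      simp only [hP]
      rw [norm_mul, norm_div]
      have h1 := zderiv_bound hA0 hps hcA hz
      have h2 : ‖1 + z * deriv g z‖ ≤ 1 + A * SS := (norm_add_le _ _).trans (by simpa using h1)
      have h3 : ‖1 + z‖ ≤ 5/4 := (norm_add_le _ _).trans (by simp; linarith)
      have h4 : 3/4 ≤ ‖1 - z‖ := by
        have := norm_sub_norm_le (1:ℂ) z
        rw [norm_one] at this; linarith
      have h5 : ‖1 + z‖ / ‖1 - z‖ ≤ 2 := by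
        rw [div_le_iff₀ (by linarith)]; linarith
      gcongr
  · intro k hk
    have pe := ((ps_cf (gt_diff hε hε1 hg)).add (hps.smul (-1))).add ((ps_cf hPd).smul ε)
    have := pe.bound (R := 1/4) (M := (5 * (A * SS) + 5) * ε ^ 2) (by norm_num) (by norm_num) ?_ (k+1)
    · rw [← hPc]
      have e : cf (gt' g ε) (k+1) - (cf g (k+1) - ε * cf P (k+1)) = cf (gt' g ε) (k+1) + -1 * cf g (k+1) + ε * cf P (k+1) := by ring
      rw [e]
      refine this.trans ?_
      rw [div_eq_mul_inv, ← inv_pow, mul_right_comm]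
      norm_num
      gcongr
      · norm_num
      · omega
    · intro z hz
      have hz1 : ‖z‖ < 1 := by linarith
      have q1 := qq_norm (c := 1 - ε) (by linarith) (by linarith) hz1
      have q2 : ‖qq (1 - ε) z - 1‖ ≤ 2 * ε := by
        refine (qq_sub_norm (by linarith) (by linarith) hz1).trans ?_
        have : (1 + ‖z‖) / (1 - ‖z‖) ≤ 2 := by rw [div_le_iff₀ (by linarith)]; linarith
        nlinarith
      have t1 := comp_taylor hA0 hps hcA hz q1.le
      have t2 := norm_log_one_add_sub_self_le (z := qq (1-ε) z - 1) (by linarith)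
      rw [add_sub_cancel] at t2
      have t3 := zderiv_bound hA0 hps hcA hz
      have h3 : ‖1 + z‖ ≤ 5/4 := (norm_add_le _ _).trans (by simp; linarith)
      have h4 : 3/4 ≤ ‖1 - z‖ := by
        have := norm_sub_norm_le (1:ℂ) z
        rw [norm_one] at this; linarith
      have h6 : 3/4 ≤ ‖1 - (1 - ε : ℝ) * z‖ := le_trans (by linarith) (qq_den (c := 1 - ε) (by linarith) (by linarith) (z := z))
      have hsq : ‖qq (1-ε) z - 1‖ ^ 2 ≤ 4 * ε ^ 2 := by
        calc _ ≤ (2 * ε) ^ 2 := by gcongr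
          _ = _ := by ring
      have t2' : ‖log (qq (1-ε) z) - (qq (1-ε) z - 1)‖ ≤ 4 * ε ^ 2 := by
        refine t2.trans ?_
        have : (1 - ‖qq (1-ε) z - 1‖)⁻¹ ≤ 2 := by
          rw [inv_le_iff_one_le_mul₀ (by linarith)]; linarith
        have : ‖qq (1-ε) z - 1‖ ^ 2 * (1 - ‖qq (1-ε) z - 1‖)⁻¹ ≤ ‖qq (1-ε) z - 1‖ ^ 2 * 2 := by gcongr
        linarith
      have t4 : ‖qq (1-ε) z - 1 + ε * ((1 + z) / (1 - z))‖ ≤ ε ^ 2 := by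
        have n1 : (1 - z) ≠ 0 := by intro h; rw [h] at h4; norm_num at h4
        have n2 := mob_den (a := 1 - ε) (by linarith) (by linarith) hz1.le
        have : qq (1-ε) z - 1 + ε * ((1 + z) / (1 - z)) = ε ^ 2 * z * (1 + z) / ((1 - (1 - ε : ℝ) * z) * (1 - z)) := by
          rw [qq_sub (by linarith) (by linarith) hz1]
          push_cast at n2 ⊢
          rw [div_add' _ _ _ n2, div_eq_div_iff n2 (mul_ne_zero n2 n1)]
          field_simp
          ring
        rw [this, norm_div, norm_mul, norm_mul, norm_mul, norm_pow, norm_real, Real.norm_of_nonneg hε.le]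
        have hden : 9/16 ≤ ‖1 - (1 - ε : ℝ) * z‖ * ‖1 - z‖ := by nlinarith
        rw [div_le_iff₀ (by linarith)]
        have : ε ^ 2 * ‖z‖ * ‖1 + z‖ ≤ ε ^ 2 * (1/4) * (5/4) := by gcongr
        have : ε ^ 2 * (9/16) ≤ ε ^ 2 * (‖1 - (1 - ε : ℝ) * z‖ * ‖1 - z‖) := by gcongr
        nlinarith [sq_nonneg ε]
      have e : gt' g ε z + -1 * g z + ε * P z =
          (g (z * qq (1-ε) z) - g z - z * deriv g z * (qq (1-ε) z - 1)) + (log (qq (1-ε) z) - (qq (1-ε) z - 1))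
          + (1 + z * deriv g z) * (qq (1-ε) z - 1 + ε * ((1 + z) / (1 - z))) := by
        simp only [gt', hP]; ring
      rw [e]
      refine (norm_add₃_le).trans ?_
      rw [norm_mul]
      have h2 : ‖1 + z * deriv g z‖ ≤ 1 + A * SS := (norm_add_le _ _).trans (by simpa using t3)
      have m1 : A * SS * ‖qq (1-ε) z - 1‖ ^ 2 ≤ A * SS * (4 * ε ^ 2) := by gcongr
      have m2 : ‖1 + z * deriv g z‖ * ‖qq (1-ε) z - 1 + ε * ((1 + z) / (1 - z))‖ ≤ (1 + A * SS) * ε ^ 2 := by gcongr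
      linarith


structure GG (n : ℕ) (φ ψ : ℂ → ℂ) (K : ℝ) (g : ℂ → ℂ) (l : ℂ) : Prop where
  l1 : ‖l‖ = 1
  d : DifferentiableOn ℂ g (ball 0 (1/2))
  re : ∀ z ∈ ball (0:ℂ) (1/2), (g z).re ≤ 0
  eq : ∀ z ∈ ball (0:ℂ) (1/2), φ z = l * ψ z * exp (g (ψ z))
  Q : ∀ r : ℝ, 0 ≤ r → r < 1 → NN n (cf g) r + 4 * Real.log (1 - r) ≤ K * (-(g 0).re)

structure Sp (n : ℕ) (φ : ℂ → ℂ) (K : ℝ) (ψ : ℂ → ℂ) : Prop where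
  nice : Nice ψ
  ex : ∃ g l, GG n φ ψ K g l

lemma GG.deriv {n : ℕ} {φ ψ g : ℂ → ℂ} {K : ℝ} {l : ℂ} (hψ : Nice ψ) (h : GG n φ ψ K g l) :
    ‖deriv φ 0‖ = ‖deriv ψ 0‖ * Real.exp (g 0).re := by
  have h1 := hψ.hasDeriv
  have h2 : HasDerivAt g (_root_.deriv g 0) (ψ 0) := by
    rw [hψ.z]; exact (h.d.differentiableAt (isOpen_ball.mem_nhds (by simp))).hasDerivAt
  have h3 := (h1.const_mul l).mul (h2.comp (0:ℂ) h1).cexp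
  have h4 : φ =ᶠ[𝓝 0] fun z => l * ψ z * exp (g (ψ z)) := by
    filter_upwards [isOpen_ball.mem_nhds (show (0:ℂ) ∈ ball (0:ℂ) (1/2) by simp)] with z hz using h.eq z hz
  have h5 := (h3.congr_of_eventuallyEq h4).deriv
  rw [h5]
  simp [hψ.z, h.l1, Complex.norm_exp]

lemma Sp.rot {n : ℕ} {φ ψ : ℂ → ℂ} {K : ℝ} (h : Sp n φ K ψ) {u : ℂ} (hu : ‖u‖ = 1) :
    Sp n φ K (fun z => u * ψ z) := by
  obtain ⟨hN, g, l, hg⟩ := h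
  have hu0 : u ≠ 0 := by intro h; rw [h] at hu; simp at hu
  have hui : ‖u⁻¹‖ = 1 := by rw [norm_inv, hu, inv_one]
  refine ⟨⟨hN.d.const_mul u, ?_, ?_, by simp [hN.z]⟩, fun z => g (u⁻¹ * z), l * u⁻¹, ⟨by rw [norm_mul, hg.l1, hui, one_mul], ?_, ?_, ?_, ?_⟩⟩
  · intro z hz w hw hzw
    exact hN.i hz hw (mul_left_cancel₀ hu0 hzw)
  · intro z hz
    have := hN.m z hz
    simpa [hu] using this
  · refine hg.d.comp (differentiableOn_id.const_mul _) ?_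
    intro z hz; simp at hz; simpa [hu] using hz
  · intro z hz
    apply hg.re
    simp at hz; simpa [hu] using hz
  · intro z hz
    rw [hg.eq z hz, inv_mul_cancel_left₀ hu0]
    field_simp
  · have hps : PS (1/2) (fun k => u⁻¹ ^ k * cf g k) (fun z => g (u⁻¹ * z)) := by
      intro z hz
      have := ps_cf hg.d (u⁻¹ * z) (by rw [norm_mul, hui, one_mul]; exact hz)
      convert! this using 2 with k
      rw [mul_pow]; ring
    have hc := hps.eq_cf (by norm_num)
    intro r hr0 hr
    have := hg.Q r hr0 hr
    have e : NN n (cf fun z => g (u⁻¹ * z)) r = NN n (cf g) r := by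
      unfold NN
      rw [hc]
      simp [norm_mul, hu]
    rw [e]; simpa using this

lemma Sp.step {n : ℕ} {φ ψ : ℂ → ℂ} {T C ε₀ : ℝ} (hC0 : 0 ≤ C) (hTd : ‖deriv φ 0‖ = Real.exp (-T))
    (hC : ∀ (g : ℂ → ℂ) (ε : ℝ),
    DifferentiableOn ℂ g (ball 0 (1/2)) → (∀ z ∈ ball (0:ℂ) (1/2), (g z).re ≤ 0) → -T ≤ (g 0).re →
    0 < ε → ε ≤ 1/8 → ∀ r : ℝ, 0 ≤ r → r < 1 → ∃ w, 0 ≤ w ∧ w < 1 ∧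
      NN n (cf (gt' g ε)) r + 4 * Real.log (1 - r) ≤ NN n (cf g) w + 4 * Real.log (1 - w) + C * ε ^ 2)
    (hε₀ : ε₀ ≤ 1/8)
    (h : Sp n φ (C * ε₀) ψ) {b : ℝ} (hb0 : 0 < b) (hb1 : b < 1) {ω : ℂ} (hω : ‖ω‖ = b ^ 2)
    (hom : ω ∉ ψ '' ball 0 1) (hb : 1 - 2 * b / (1 + b ^ 2) ≤ ε₀) :
    ∃ ψ₁, Sp n φ (C * ε₀) ψ₁ ∧ ‖deriv ψ 0‖ = 2 * b / (1 + b ^ 2) * ‖deriv ψ₁ 0‖ := by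
  -- rotate
  have hω0 : ω ≠ 0 := by intro h; rw [h, norm_zero] at hω; nlinarith
  have hu : ‖((b^2 : ℝ) : ℂ) / ω‖ = 1 := by
    rw [norm_div, norm_real, Real.norm_of_nonneg (by positivity), hω, div_self (by positivity)]
  set u := ((b^2 : ℝ) : ℂ) / ω with hu'
  obtain ⟨hN, g, l, hg⟩ := h.rot hu
  have hdu : ‖deriv (fun z => u * ψ z) 0‖ = ‖deriv ψ 0‖ := by
    rw [(h.nice.hasDeriv.const_mul u).deriv, norm_mul, hu, one_mul]
  have hom' : ∀ z ∈ ball (0:ℂ) 1, u * ψ z ≠ ((b ^ 2 : ℝ) : ℂ) := by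
    intro z hz he
    apply hom
    refine ⟨z, hz, ?_⟩
    have hb2 : ((b^2 : ℝ) : ℂ) ≠ 0 := by exact_mod_cast (by positivity : b ^ 2 ≠ 0)
    rw [hu', div_mul_eq_mul_div, div_eq_iff hω0] at he
    exact mul_left_cancel₀ hb2 he
  have hgT : -T ≤ (g 0).re := by
    have h1 := hg.deriv hN
    rw [hTd] at h1
    have h2 : Real.exp (-T) ≤ Real.exp (g 0).re := by
      rw [h1]; exact mul_le_of_le_one_left (Real.exp_pos _).le hN.deriv_le
    exact Real.exp_le_exp.1 h2
  obtain ⟨ψ₁, hN₁, hψ₁⟩ := koebe_step hN hb0 hb1 hom'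
  set c := 2 * b / (1 + b ^ 2) with hc
  have hc1 : c < 1 := by rw [hc, div_lt_one (by positivity)]; nlinarith
  have hc0 : 0 < c := by positivity
  obtain ⟨ε, hε⟩ : ∃ ε, ε = 1 - c := ⟨_, rfl⟩
  have hcε : c = 1 - ε := by linarith
  have hε0 : 0 < ε := by linarith
  have hε1 : ε ≤ ε₀ := by linarith
  have hε8 : ε ≤ 1/8 := by linarith
  have hψ₁' : ∀ z ∈ ball (0:ℂ) 1, u * ψ z = ψ₁ z * qq (1 - ε) (ψ₁ z) := by
    intro z hz; rw [hψ₁ z hz, hcε, qq]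
  have hGG : GG n φ ψ₁ (C * ε₀) (gt' g ε) l := by
    refine ⟨hg.l1, gt_diff hε0 hε8 hg.d, gt_re hε0 hε8 hg.re, ?_, ?_⟩
    · intro z hz
      simp at hz
      have h1 := hN₁.norm_le (z := z) (by linarith)
      have h2 := slitPlane_ne_zero (qq_slit hε0 hε8 (z := ψ₁ z) (by linarith))
      rw [hg.eq z (by simpa using hz), hψ₁' z (by simp; linarith), gt', exp_add, exp_log h2]
      ring
    · intro r hr0 hr
      obtain ⟨w, hw0, hw1, hw⟩ := hC g ε hg.d hg.re hgT hε0 hε8 r hr0 hr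
      have h1 := hg.Q w hw0 hw1
      rw [gt_zero hε0 hε8]
      have h2 := Real.log_le_sub_one_of_pos (show 0 < 1 - ε by linarith)
      have h3 : C * ε ^ 2 ≤ C * ε₀ * (-Real.log (1 - ε)) := by
        have : C * ε ^ 2 ≤ C * ε₀ * ε := by
          rw [pow_two, ← mul_assoc]; gcongr
        refine this.trans (mul_le_mul_of_nonneg_left (by linarith) ?_)
        exact mul_nonneg hC0 (by linarith)
      nlinarith
  refine ⟨ψ₁, ⟨hN₁, _, _, hGG⟩, ?_⟩
  have d1 := hg.deriv hN
  have d2 := hGG.deriv hN₁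
  rw [d1, hdu, gt_zero hε0 hε8, Real.exp_add, Real.exp_log (by linarith)] at d2
  have := Real.exp_pos (g 0).re
  apply mul_right_cancel₀ this.ne'
  rw [d2, hcε]; ring

lemma chain {n : ℕ} {φ : ℂ → ℂ} (hφ : Nice φ) {T C ε₀ : ℝ} (hC0 : 0 ≤ C) (hTd : ‖deriv φ 0‖ = Real.exp (-T))
    (hC : ∀ (g : ℂ → ℂ) (ε : ℝ),
    DifferentiableOn ℂ g (ball 0 (1/2)) → (∀ z ∈ ball (0:ℂ) (1/2), (g z).re ≤ 0) → -T ≤ (g 0).re →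
    0 < ε → ε ≤ 1/8 → ∀ r : ℝ, 0 ≤ r → r < 1 → ∃ w, 0 ≤ w ∧ w < 1 ∧
      NN n (cf (gt' g ε)) r + 4 * Real.log (1 - r) ≤ NN n (cf g) w + 4 * Real.log (1 - w) + C * ε ^ 2)
    (hε : 0 < ε₀) (hε₀ : ε₀ ≤ 1/8) : ∃ ψ, Sp n φ (C * ε₀) ψ ∧ 1 - ε₀ ≤ ‖deriv ψ 0‖ ∧ deriv ψ 0 = (‖deriv ψ 0‖ : ℂ) := by
  suffices h : ∃ ψ, Sp n φ (C * ε₀) ψ ∧ 1 - ε₀ ≤ ‖deriv ψ 0‖ by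
    obtain ⟨ψ, h1, h2⟩ := h
    have hpos : 0 < ‖deriv ψ 0‖ := by linarith
    have hne : deriv ψ 0 ≠ 0 := norm_pos_iff.1 hpos
    have hu : ‖(‖deriv ψ 0‖ : ℂ) / deriv ψ 0‖ = 1 := by
      rw [norm_div, norm_real, norm_norm, div_self hpos.ne']
    have hd := (h1.nice.hasDeriv.const_mul ((‖deriv ψ 0‖ : ℂ) / deriv ψ 0)).deriv
    rw [div_mul_cancel₀ _ hne] at hd
    refine ⟨_, h1.rot hu, ?_, ?_⟩
    · rw [hd]; simpa using h2
    · rw [hd]; simp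
  have hinit : Sp n φ (C * ε₀) φ := by
    refine ⟨hφ, fun _ => 0, 1, ⟨by simp, by fun_prop, by simp, by simp, ?_⟩⟩
    intro r hr0 hr
    have : NN n (cf fun _ => 0) r = 0 := by
      unfold NN
      have hps : PS 1 (fun _ => 0) (fun _ : ℂ => (0:ℂ)) := fun z _ => by simpa using hasSum_zero
      rw [hps.eq_cf one_pos]; simp
    rw [this]
    have := Real.log_nonpos (show 0 ≤ 1 - r by linarith) (by linarith)
    simp; linarith
  set A := {x : ℝ | ∃ ψ, Sp n φ (C * ε₀) ψ ∧ x = ‖deriv ψ 0‖} with hA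
  have hbdd : BddAbove A := ⟨1, by rintro x ⟨ψ, h, rfl⟩; exact h.nice.deriv_le⟩
  have hm : 0 < sSup A := by
    refine lt_of_lt_of_le ?_ (le_csSup hbdd ⟨φ, hinit, rfl⟩)
    rw [hTd]; exact Real.exp_pos _
  set b := Real.sqrt (1 - ε₀) with hb
  have hb2 : b ^ 2 = 1 - ε₀ := Real.sq_sqrt (by linarith)
  have hb0 : 0 < b := Real.sqrt_pos.2 (by linarith)
  have hb1 : b < 1 := by nlinarith
  have hc1 : 2 * b / (1 + b ^ 2) < 1 := by rw [div_lt_one (by positivity)]; nlinarith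
  have hcε : 1 - 2 * b / (1 + b ^ 2) ≤ ε₀ := by
    have : 1 - ε₀ ≤ 2 * b / (1 + b ^ 2) := by
      rw [le_div_iff₀ (by positivity), ← hb2]; nlinarith
    linarith
  obtain ⟨x, ⟨ψ, hψ, rfl⟩, hx⟩ := exists_lt_of_lt_csSup (⟨_, φ, hinit, rfl⟩ : A.Nonempty)
    (show 2 * b / (1 + b ^ 2) * sSup A < sSup A by nlinarith)
  refine ⟨ψ, hψ, ?_⟩
  apply hψ.nice.deriv_ge (by linarith)
  intro ω hω
  by_contra hno
  obtain ⟨ψ₁, h1, h2⟩ := hψ.step hC0 hTd hC hε₀ hb0 hb1 (ω := ω) (by rw [hb2]; simpa using hω) hno hcε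
  have h3 := le_csSup hbdd (⟨ψ₁, h1, rfl⟩ : ‖deriv ψ₁ 0‖ ∈ A)
  rw [h2] at hx
  have : 0 < 2 * b / (1 + b ^ 2) := by positivity
  nlinarith


lemma thm1 {φ gφ : ℂ → ℂ} (hφ : Nice φ) (hgφ : DifferentiableOn ℂ gφ (ball 0 (1/2)))
    (hφg : ∀ z ∈ ball (0:ℂ) (1/2), φ z = z * exp (gφ z)) (n : ℕ) {r : ℝ} (hr0 : 0 ≤ r) (hr : r < 1) :
    NN n (cf gφ) r ≤ -4 * Real.log (1 - r) := by
  have hdφ : deriv φ 0 = exp (gφ 0) := by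
    have h2 := (hgφ.differentiableAt (isOpen_ball.mem_nhds (show (0:ℂ) ∈ ball (0:ℂ) (1/2) by simp))).hasDerivAt
    have h3 := (hasDerivAt_id (0:ℂ)).mul h2.cexp
    have h4 : φ =ᶠ[𝓝 0] fun z => z * exp (gφ z) := by
      filter_upwards [isOpen_ball.mem_nhds (show (0:ℂ) ∈ ball (0:ℂ) (1/2) by simp)] with z hz using hφg z hz
    have h5 := (h3.congr_of_eventuallyEq h4).deriv
    rw [h5]; simp
  obtain ⟨T, hT⟩ : ∃ T, T = -(gφ 0).re := ⟨_, rfl⟩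
  have hTd : ‖deriv φ 0‖ = Real.exp (-T) := by rw [hdφ, norm_exp, hT, neg_neg]
  have hT0 : 0 ≤ T := by
    have := hφ.deriv_le
    rw [hTd, Real.exp_le_one_iff] at this; linarith
  obtain ⟨C, hC0, hC⟩ := step_lemma n T hT0
  set A := 6 * (T + 1) with hA
  have hA0 : 0 ≤ A := by positivity
  have hS := SS_nonneg
  set D := (2 * (A * SS) + 2) * 3 * 4 ^ n with hD
  have key : ∀ ε, 0 < ε → ε ≤ 1/8 → NN n (cf gφ) r ≤ -4 * Real.log (1 - r) +
      (C * T + ∑ k ∈ Finset.range n, ((k:ℝ) + 1) * (2 * ‖cf gφ (k+1)‖ * D)) * ε := by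
    intro ε hε hε8
    obtain ⟨ψ, ⟨hN, g, l, hg⟩, hψ1, hψ2⟩ := chain hφ hC0 hTd hC hε hε8
    have hgT : -T ≤ (g 0).re := by
      have h1 := hg.deriv hN
      rw [hTd] at h1
      have h2 : Real.exp (-T) ≤ Real.exp (g 0).re := by
        rw [h1]; exact mul_le_of_le_one_left (Real.exp_pos _).le hN.deriv_le
      exact Real.exp_le_exp.1 h2
    have hps := ps_cf hg.d
    have hcA : ∀ k, 1 ≤ k → ‖cf g k‖ ≤ A * (8/3) ^ k := bc_coef hT0 hg.d hg.re hgT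
    -- q
    set q := dslope ψ 0 with hq
    have hqd : DifferentiableOn ℂ q (ball 0 1) :=
      (differentiableOn_dslope (isOpen_ball.mem_nhds (by simp))).2 hN.d
    have hq0 : q 0 = (‖deriv ψ 0‖ : ℂ) := by rw [hq, dslope_same, hψ2]; simp
    have hψq : ∀ z, ψ z = z * q z := by
      intro z
      have := sub_smul_dslope ψ 0 z
      rw [hN.z] at this
      simpa using this.symm
    have hqn : ∀ z : ℂ, ‖z‖ < 1 → ‖q z‖ ≤ 1 := by
      intro z hz
      by_cases h0 : z = 0
      · rw [h0, hq0]; simpa using hN.deriv_le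
      · have := hN.norm_le hz
        rw [hψq, norm_mul] at this
        have hz0 := norm_pos_iff.2 h0
        nlinarith
    have hq1 : ∀ z : ℂ, ‖z‖ < 1/2 → ‖q z - 1‖ ≤ 3 * ε := by
      intro z hz
      have := borelCaratheodory_zero (M := ε) (R := 1) (z := z) (f := fun z => q z - q 0) hε (hqd.sub_const _)
        (fun w hw => by
          have h1 := (re_le_norm _).trans (hqn w (by simpa using hw))
          simp only [mem_ofPred_eq, sub_re, hq0, ofReal_re]; linarith) one_pos (by simp; linarith) (by simp)
      have h2 : 2 * ε * ‖z‖ / (1 - ‖z‖) ≤ 2 * ε := by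
        rw [div_le_iff₀ (by linarith)]; nlinarith [norm_nonneg z]
      have h3 : ‖q 0 - 1‖ ≤ ε := by
        rw [hq0, ← ofReal_one, ← ofReal_sub, norm_real, Real.norm_eq_abs, abs_le]
        have := hN.deriv_le
        constructor <;> linarith
      calc ‖q z - 1‖ = ‖(q z - q 0) + (q 0 - 1)‖ := by ring_nf
        _ ≤ _ := norm_add_le _ _
        _ ≤ _ := by linarith
    have hqs : ∀ z : ℂ, ‖z‖ < 1/2 → q z ∈ slitPlane := by
      intro z hz
      have := mem_slitPlane_of_norm_lt_one (z := q z - 1) (by have := hq1 z hz; linarith)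
      simpa using this
    have hqd' := hqd.mono (ball_subset_ball (show (1/2:ℝ) ≤ 1 by norm_num))
    have hhd : DifferentiableOn ℂ (fun z => g (z * q z) + log (q z)) (ball 0 (1/2)) := by
      refine DifferentiableOn.add ?_ (hqd'.clog fun z hz => hqs z (by simpa using hz))
      refine hg.d.comp (differentiableOn_id.mul hqd') ?_
      intro z hz
      simp at hz ⊢
      have := hqn z (by linarith)
      nlinarith [norm_nonneg z, norm_nonneg (q z)]
    have hexp : ∀ z ∈ ball (0:ℂ) (1/2), exp (gφ z) = l * exp (g (z * q z) + log (q z)) := by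
      have hne : ∀ z ∈ ball (0:ℂ) (1/2), z ≠ 0 → exp (gφ z) = l * exp (g (z * q z) + log (q z)) := by
        intro z hz h0
        have h1 := hg.eq z hz
        rw [hφg z hz, hψq] at h1
        apply mul_left_cancel₀ h0
        rw [h1, exp_add, exp_log (slitPlane_ne_zero (hqs z (by simpa using hz)))]
        ring
      intro z hz
      by_cases h0 : z = 0
      · subst h0
        have c1 : ContinuousAt (fun z => exp (gφ z)) 0 :=
          ((hgφ.differentiableAt (isOpen_ball.mem_nhds hz)).cexp).continuousAt
        have c2 : ContinuousAt (fun z => l * exp (g (z * q z) + log (q z))) 0 :=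
          ((hhd.differentiableAt (isOpen_ball.mem_nhds hz)).cexp.const_mul l).continuousAt
        have := (c1.eventuallyEq_nhds_iff_eventuallyEq_nhdsNE c2).1 (by
          filter_upwards [self_mem_nhdsWithin, mem_nhdsWithin_of_mem_nhds (isOpen_ball.mem_nhds hz)] with w hw hw'
          exact hne w hw' hw)
        exact this.eq_of_nhds
      · exact hne z hz h0
    have hcf : ∀ k, 1 ≤ k → cf gφ k = cf (fun z => g (z * q z) + log (q z)) k :=
      fun k hk => cf_eq_of_exp (by norm_num) hgφ hhd hexp k hk
    have hdiff : ∀ k < n, ‖cf gφ (k+1) - cf g (k+1)‖ ≤ D * ε := by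
      intro k hk
      have pe := (ps_cf hhd).add (hps.smul (-1))
      have := pe.bound (R := 1/4) (M := (2 * (A * SS) + 2) * 3 * ε) (by norm_num) (by norm_num) ?_ (k+1)
      · rw [hcf _ (by omega)]
        have e : ∀ x y : ℂ, x - y = x + -1 * y := by intros; ring
        rw [e]
        refine this.trans ?_
        rw [div_eq_mul_inv, ← inv_pow, hD, mul_right_comm]
        norm_num
        gcongr
        · norm_num
        · omega
      · intro z hz
        have q1 := hqn z (by linarith)
        have q2 := hq1 z (by linarith)
        have t1 := comp_taylor hA0 hps hcA hz q1
        have t2 := norm_log_one_add_half_le_self (z := q z - 1) (by linarith)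
        rw [add_sub_cancel] at t2
        have t3 := zderiv_bound hA0 hps hcA hz
        have e : g (z * q z) + log (q z) + -1 * g z = (g (z * q z) - g z - z * deriv g z * (q z - 1)) + z * deriv g z * (q z - 1) + log (q z) := by ring
        rw [e]
        refine norm_add₃_le.trans ?_
        rw [norm_mul (z * deriv g z)]
        have hAS : 0 ≤ A * SS := by positivity
        have m1 : A * SS * ‖q z - 1‖ ^ 2 ≤ A * SS * (3 * ε) := by
          gcongr
          nlinarith [norm_nonneg (q z - 1)]
        have m2 : ‖z * deriv g z‖ * ‖q z - 1‖ ≤ A * SS * (3 * ε) := by gcongr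
        nlinarith
    have hQ := hg.Q r hr0 hr
    have hle : NN n (cf gφ) r ≤ NN n (cf g) r + (∑ k ∈ Finset.range n, ((k:ℝ) + 1) * (2 * ‖cf gφ (k+1)‖ * D)) * ε := by
      unfold NN
      rw [Finset.sum_mul, ← Finset.sum_add_distrib]
      refine Finset.sum_le_sum fun k hk => ?_
      have h1 := hdiff k (Finset.mem_range.1 hk)
      set x := cf gφ (k+1)
      set y := cf g (k+1)
      have hxy : ‖x‖ ≤ ‖y‖ + D * ε := by
        have := norm_sub_norm_le x y; linarith
      have hDε : 0 ≤ D * ε := by positivity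
      have hsq : ‖x‖ ^ 2 ≤ ‖y‖ ^ 2 + 2 * ‖x‖ * (D * ε) := by
        rcases le_total ‖x‖ (D * ε) with h | h
        · nlinarith [norm_nonneg x, sq_nonneg ‖y‖]
        · nlinarith [norm_nonneg x, norm_nonneg y]
      have hrp : r ^ (k+1) ≤ 1 := pow_le_one₀ hr0 hr.le
      have hrp0 : 0 ≤ r ^ (k+1) := pow_nonneg hr0 _
      calc ((k:ℝ) + 1) * ‖x‖ ^ 2 * r ^ (k+1) ≤ ((k:ℝ) + 1) * (‖y‖ ^ 2 + 2 * ‖x‖ * (D * ε)) * r ^ (k+1) := by gcongr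
        _ = ((k:ℝ) + 1) * ‖y‖ ^ 2 * r ^ (k+1) + ((k:ℝ) + 1) * (2 * ‖x‖ * D) * ε * r ^ (k+1) := by ring
        _ ≤ ((k:ℝ) + 1) * ‖y‖ ^ 2 * r ^ (k+1) + ((k:ℝ) + 1) * (2 * ‖x‖ * D) * ε * 1 := by gcongr
        _ = _ := by ring
    have hCT : C * ε * (-(g 0).re) ≤ C * T * ε := by
      calc C * ε * (-(g 0).re) ≤ C * ε * T := by gcongr; linarith
        _ = _ := by ring
    linarith
  set K := C * T + ∑ k ∈ Finset.range n, ((k:ℝ) + 1) * (2 * ‖cf gφ (k+1)‖ * D) with hK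
  have hK0 : 0 ≤ K := by positivity
  refine le_of_forall_pos_le_add fun δ hδ => ?_
  have h1 : 0 < δ / (K + 1) := by positivity
  have := key (min (1/8) (δ / (K + 1))) (lt_min (by norm_num) h1) (min_le_left _ _)
  refine this.trans ?_
  gcongr
  calc K * min (1/8) (δ / (K+1)) ≤ K * (δ / (K+1)) := by gcongr; exact min_le_right _ _
    _ ≤ (K+1) * (δ / (K+1)) := by gcongr; linarith
    _ = δ := by field_simp


lemma lm_deriv (y : ℕ → ℝ) (m : ℕ) (r : ℝ) :
    HasDerivAt (fun r => ∑ k ∈ Finset.range m, y k * r ^ k) (∑ k ∈ Finset.range m, y k * (k * r ^ (k-1))) r :=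
  HasDerivAt.fun_sum fun k _ => (hasDerivAt_pow k r).const_mul (y k)

lemma lm_rderiv (y : ℕ → ℝ) (m : ℕ) (r : ℝ) :
    r * (∑ k ∈ Finset.range m, y k * (k * r ^ (k-1))) = ∑ k ∈ Finset.range m, k * y k * r ^ k := by
  rw [Finset.mul_sum]
  refine Finset.sum_congr rfl fun k _ => ?_
  rcases k with _ | k
  · simp
  · simp; ring

lemma lebedev_milin {β γ : ℕ → ℂ} (h0 : β 0 = 1)
    (hrec : ∀ k : ℕ, (k:ℂ) * β k = ∑ p ∈ Finset.HasAntidiagonal.antidiagonal k, (p.1:ℂ) * γ p.1 * β p.2) (n : ℕ) {r : ℝ} (hr : 0 ≤ r) :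
    ∑ k ∈ Finset.range (n+1), ‖β k‖ ^ 2 * r ^ k ≤ Real.exp (NN n γ r) := by
  -- Cauchy-Schwarz
  have hcs : ∀ k : ℕ, (k:ℝ) * ‖β k‖ ^ 2 ≤ ∑ p ∈ Finset.HasAntidiagonal.antidiagonal k, ((p.1:ℝ) * ((p.1:ℝ) * ‖γ p.1‖ ^ 2)) * ‖β p.2‖ ^ 2 := by
    intro k
    rcases Nat.eq_zero_or_pos k with rfl | hk
    · simp
    obtain ⟨m, rfl⟩ : ∃ m, k = m + 1 := ⟨k - 1, by omega⟩
    have e := hrec (m+1)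
    rw [Finset.Nat.sum_antidiagonal_succ] at e
    rw [Finset.Nat.sum_antidiagonal_succ]
    simp only [Nat.cast_zero, zero_mul, zero_add] at e ⊢
    have h1 : ((m+1 : ℕ) : ℝ) * ‖β (m+1)‖ ≤ ∑ p ∈ Finset.HasAntidiagonal.antidiagonal m, ((p.1+1 : ℕ):ℝ) * ‖γ (p.1+1)‖ * ‖β p.2‖ := by
      rw [← norm_natCast (α := ℂ), ← norm_mul, e]
      refine (norm_sum_le _ _).trans (le_of_eq ?_)
      refine Finset.sum_congr rfl fun p _ => ?_
      rw [norm_mul, norm_mul, norm_natCast]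
    have h2 := sq_sum_le_card_mul_sum_sq (s := Finset.HasAntidiagonal.antidiagonal m) (f := fun p => ((p.1+1 : ℕ):ℝ) * ‖γ (p.1+1)‖ * ‖β p.2‖)
    rw [Finset.Nat.card_antidiagonal] at h2
    have h3 : (((m+1 : ℕ) : ℝ) * ‖β (m+1)‖) ^ 2 ≤ (∑ p ∈ Finset.HasAntidiagonal.antidiagonal m, ((p.1+1 : ℕ):ℝ) * ‖γ (p.1+1)‖ * ‖β p.2‖) ^ 2 := by
      gcongr
    have h4 := h3.trans h2
    have hm : (0:ℝ) < ((m+1 : ℕ) : ℝ) := by positivity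
    have h5 : ((m+1 : ℕ) : ℝ) * (((m+1 : ℕ) : ℝ) * ‖β (m+1)‖ ^ 2) ≤ ((m+1 : ℕ) : ℝ) * ∑ p ∈ Finset.HasAntidiagonal.antidiagonal m, (((p.1+1 : ℕ):ℝ) * ‖γ (p.1+1)‖ * ‖β p.2‖) ^ 2 := by
      calc _ = (((m+1 : ℕ) : ℝ) * ‖β (m+1)‖) ^ 2 := by ring
        _ ≤ _ := h4
    have h6 := le_of_mul_le_mul_left h5 hm
    refine h6.trans (le_of_eq ?_)
    refine Finset.sum_congr rfl fun p _ => ?_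
    ring
  set x : ℕ → ℝ := fun k => ‖β k‖ ^ 2 with hx
  set α : ℕ → ℝ := fun k => (k:ℝ) * ‖γ k‖ ^ 2 with hα
  have hx0 : ∀ k, 0 ≤ x k := fun k => by positivity
  have hα0 : ∀ k, 0 ≤ α k := fun k => by positivity
  set S := fun r : ℝ => ∑ k ∈ Finset.range (n+1), x k * r ^ k with hS
  set A := fun r : ℝ => ∑ k ∈ Finset.range (n+1), α k * r ^ k with hA
  have hNN : NN n γ r = A r := by
    simp only [NN, hA, hα]
    rw [Finset.sum_range_succ']
    simp
  have hSd := lm_deriv x (n+1)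
  have hAd := lm_deriv α (n+1)
  have hFd : ∀ r, HasDerivAt (fun r => S r * Real.exp (- A r)) _ r := fun r => (hSd r).mul ((hAd r).neg.exp)
  have hanti : AntitoneOn (fun r => S r * Real.exp (- A r)) (Ici 0) := by
    refine antitoneOn_of_deriv_nonpos (convex_Ici 0) (fun r _ => (hFd r).continuousAt.continuousWithinAt)
      (fun r _ => (hFd r).differentiableAt.differentiableWithinAt) ?_
    intro r hr
    rw [interior_Ici] at hr
    have hr : 0 < r := hr
    rw [(hFd r).deriv]
    have key : r * (∑ k ∈ Finset.range (n+1), x k * (k * r ^ (k-1))) ≤ r * (∑ k ∈ Finset.range (n+1), α k * (k * r ^ (k-1))) * S r := by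
      rw [lm_rderiv, lm_rderiv]
      calc ∑ k ∈ Finset.range (n+1), k * x k * r ^ k
          ≤ ∑ k ∈ Finset.range (n+1), ∑ p ∈ Finset.HasAntidiagonal.antidiagonal k, ((p.1:ℝ) * α p.1 * r ^ p.1) * (x p.2 * r ^ p.2) := by
            refine Finset.sum_le_sum fun k _ => ?_
            have := mul_le_mul_of_nonneg_right (hcs k) (pow_nonneg hr.le k)
            refine this.trans (le_of_eq ?_)
            rw [Finset.sum_mul]
            refine Finset.sum_congr rfl fun p hp => ?_
            rw [← Finset.HasAntidiagonal.mem_antidiagonal.1 hp, pow_add]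
            ring
        _ = ∑ q ∈ (Finset.range (n+1)).sigma (fun k => Finset.HasAntidiagonal.antidiagonal k), ((q.2.1:ℝ) * α q.2.1 * r ^ q.2.1) * (x q.2.2 * r ^ q.2.2) := by
            rw [Finset.sum_sigma]
        _ ≤ ∑ p ∈ Finset.range (n+1) ×ˢ Finset.range (n+1), ((p.1:ℝ) * α p.1 * r ^ p.1) * (x p.2 * r ^ p.2) := by
            have hinj : ∀ q ∈ (Finset.range (n+1)).sigma (fun k => Finset.HasAntidiagonal.antidiagonal k), ∀ q' ∈ (Finset.range (n+1)).sigma (fun k => Finset.HasAntidiagonal.antidiagonal k), q.2 = q'.2 → q = q' := by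
              rintro ⟨k, p⟩ h1 ⟨k', p'⟩ h2 h
              simp at h1 h2 h
              subst h
              have : k = k' := by rw [← h1.2, ← h2.2]
              subst this; rfl
            rw [← Finset.sum_image (f := fun p : ℕ × ℕ => ((p.1:ℝ) * α p.1 * r ^ p.1) * (x p.2 * r ^ p.2)) (g := fun q : (Σ _ : ℕ, ℕ × ℕ) => q.2) hinj]
            refine Finset.sum_le_sum_of_subset_of_nonneg ?_ ?_
            · intro p hp
              simp only [Finset.mem_image, Finset.mem_sigma, Finset.mem_range, Finset.HasAntidiagonal.mem_antidiagonal] at hp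
              obtain ⟨q, ⟨h1, h2⟩, rfl⟩ := hp
              simp only [Finset.mem_product, Finset.mem_range]
              omega
            · intro p _ _
              have := hx0 p.2
              have := hα0 p.1
              positivity
        _ = _ := by rw [Finset.sum_product, Finset.sum_mul_sum]
    have k2 : (∑ k ∈ Finset.range (n+1), x k * (k * r ^ (k-1))) ≤ (∑ k ∈ Finset.range (n+1), α k * (k * r ^ (k-1))) * S r := by
      rw [mul_assoc] at key
      exact le_of_mul_le_mul_left key hr
    have := mul_le_mul_of_nonneg_right k2 (Real.exp_pos (-A r)).le
    change _ * Real.exp (-A r) + S r * (Real.exp (-A r) * -_) ≤ 0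
    linarith
  have h := hanti (show (0:ℝ) ∈ Ici 0 by simp) (show r ∈ Ici (0:ℝ) from hr) hr
  have hS0 : S 0 = 1 := by
    simp only [hS, hx]; rw [Finset.sum_range_succ']; simp [h0]
  have hA0' : A 0 = 0 := by
    simp only [hA, hα]; rw [Finset.sum_range_succ']; simp
  simp only [hS0, hA0', neg_zero, Real.exp_zero, mul_one] at h
  rw [Real.exp_neg] at h
  rw [hNN]
  have he := Real.exp_pos (A r)
  rwa [← div_eq_mul_inv, div_le_one he] at h


lemma PS.mul {R : ℝ} {c c' : ℕ → ℂ} {g g' : ℂ → ℂ} (h : PS R c g) (h' : PS R c' g') :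
    PS R (fun k => ∑ p ∈ Finset.HasAntidiagonal.antidiagonal k, c p.1 * c' p.2) (fun z => g z * g' z) := by
  intro z hz
  have s1 := h z hz
  have s2 := h' z hz
  have n1 := s1.summable.norm
  have n2 := s2.summable.norm
  have e := tsum_mul_tsum_eq_tsum_sum_antidiagonal_of_summable_norm n1 n2
  have s := (summable_norm_sum_mul_antidiagonal_of_summable_norm n1 n2).of_norm.hasSum
  rw [← e, s1.tsum_eq, s2.tsum_eq] at s
  convert! s using 2 with k
  rw [Finset.sum_mul]
  refine Finset.sum_congr rfl fun p hp => ?_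
  rw [← Finset.HasAntidiagonal.mem_antidiagonal.1 hp, pow_add]; ring

lemma exists_sq (z : ℂ) (hz : ‖z‖ < 1) : ∃ w : ℂ, w ^ 2 = z ∧ ‖w‖ < 1 := by
  obtain ⟨w, hw⟩ := IsAlgClosed.exists_pow_nat_eq z (n := 2) (by norm_num)
  refine ⟨w, hw, ?_⟩
  rw [← hw, norm_pow] at hz
  nlinarith [norm_nonneg w]

lemma milin_type {h γ : ℂ → ℂ} (hγ : DifferentiableOn ℂ γ (ball 0 1)) (hh : DifferentiableOn ℂ h (ball 0 1))
    (hexp : ∀ z ∈ ball (0:ℂ) 1, exp (γ z) = h z) (hinj : InjOn (fun z => z * h z ^ 2) (ball 0 1)) (n : ℕ)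
    {r : ℝ} (hr0 : 0 ≤ r) (hr : r < 1) : NN n (cf γ) r ≤ - Real.log (1 - r) := by
  have key : ∀ ρ : ℝ, 0 < ρ → ρ < 1 → NN n (cf γ) (ρ ^ 2 * r) ≤ - Real.log (1 - r) := by
    intro ρ hρ0 hρ1
    have hFd : DifferentiableOn ℂ (fun z => z * h z ^ 2) (ball 0 1) := differentiableOn_id.mul (hh.pow 2)
    obtain ⟨M, hM⟩ := (isCompact_closedBall (0:ℂ) ρ).exists_bound_of_continuousOn
      (f := fun z => z * h z ^ 2) (hFd.continuousOn.mono (closedBall_subset_ball hρ1))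
    have hM0 : 0 ≤ M := (norm_nonneg _).trans (hM 0 (by simp [hρ0.le]))
    have hmap : ∀ z ∈ ball (0:ℂ) 1, (ρ:ℂ) * z ∈ closedBall (0:ℂ) ρ := by
      intro z hz
      simp at hz ⊢
      rw [abs_of_pos hρ0]; nlinarith
    have hmap1 : ∀ z ∈ ball (0:ℂ) 1, (ρ:ℂ) * z ∈ ball (0:ℂ) 1 := fun z hz => closedBall_subset_ball hρ1 (hmap z hz)
    have hρc : (ρ:ℂ) ≠ 0 := by exact_mod_cast hρ0.ne'
    have hMc : ((M + 1 : ℝ):ℂ) ≠ 0 := by exact_mod_cast (by linarith : M + 1 ≠ 0)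
    have hN : Nice (fun z => (ρ * z) * h (ρ * z) ^ 2 / ((M + 1 : ℝ):ℂ)) := by
      refine ⟨?_, ?_, ?_, by simp⟩
      · have := hFd.comp (differentiableOn_id.const_mul (ρ:ℂ)) (s := ball (0:ℂ) 1) hmap1
        exact this.div_const _
      · intro z hz w hw hzw
        have h1 : (ρ * z) * h (ρ * z) ^ 2 = (ρ * w) * h (ρ * w) ^ 2 := by
          have := congrArg (· * ((M + 1 : ℝ):ℂ)) hzw
          simpa only [div_mul_cancel₀ _ hMc] using this
        exact mul_left_cancel₀ hρc (hinj (hmap1 z hz) (hmap1 w hw) h1)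
      · intro z hz
        have := hM _ (hmap z hz)
        rw [mem_ball_zero_iff, norm_div, norm_real, Real.norm_of_nonneg (by linarith), div_lt_one (by linarith)]
        linarith
    have hsub : ball (0:ℂ) (1/2) ⊆ ball 0 1 := ball_subset_ball (by norm_num)
    have hgd : DifferentiableOn ℂ (fun z => 2 * γ (ρ * z) + log (ρ / ((M + 1 : ℝ):ℂ))) (ball 0 (1/2)) := by
      have := hγ.comp (differentiableOn_id.const_mul (ρ:ℂ)) (s := ball (0:ℂ) (1/2)) (fun z hz => hmap1 z (hsub hz))
      exact (this.const_mul 2).add_const _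
    have hmain := thm1 hN hgd (by
      intro z hz
      rw [exp_add, exp_log (div_ne_zero hρc hMc), two_mul, exp_add, hexp _ (hmap1 z (hsub hz))]
      field_simp) n hr0 hr
    have hps : PS 1 (fun k => 2 * ((ρ:ℂ) ^ k * cf γ k) + if k = 0 then log (ρ / ((M + 1 : ℝ):ℂ)) else 0)
        (fun z => 2 * γ (ρ * z) + log (ρ / ((M + 1 : ℝ):ℂ))) := by
      refine PS.addc (PS.smul ?_ 2) _
      intro z hz
      have := ps_cf hγ (ρ * z) (by simpa using hmap1 z (by simpa using hz))
      convert! this using 2 with k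
      rw [mul_pow]; ring
    have hc := hps.eq_cf one_pos
    have e : NN n (cf (fun z => 2 * γ (ρ * z) + log (ρ / ((M + 1 : ℝ):ℂ)))) r = 4 * NN n (cf γ) (ρ ^ 2 * r) := by
      rw [hc]
      unfold NN
      rw [Finset.mul_sum]
      refine Finset.sum_congr rfl fun k _ => ?_
      simp only [Nat.add_eq_zero_iff, one_ne_zero, and_false, if_false, add_zero, norm_mul, norm_pow, norm_real, Real.norm_of_nonneg hρ0.le]
      have : ‖(2:ℂ)‖ = 2 := by simp
      rw [this]
      ring
    rw [e] at hmain
    linarith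
  have hcont : Tendsto (fun ρ : ℝ => NN n (cf γ) (ρ ^ 2 * r)) (𝓝[<] 1) (𝓝 (NN n (cf γ) (1 ^ 2 * r))) := by
    have : Continuous (fun ρ : ℝ => NN n (cf γ) (ρ ^ 2 * r)) := by unfold NN; fun_prop
    exact (this.tendsto 1).mono_left nhdsWithin_le_nhds
  rw [one_pow, one_mul] at hcont
  refine le_of_tendsto hcont ?_
  filter_upwards [Ioo_mem_nhdsLT (show (0:ℝ) < 1 by norm_num)] with ρ hρ using key ρ hρ.1 hρ.2

theorem odd_univalent_majorant_bound' (f : ℂ → ℂ) (a : ℕ → ℂ)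
    (hf : ∀ z ∈ Metric.ball (0 : ℂ) 1, HasSum (fun k : ℕ => a k * z ^ (2 * k + 1)) (f z))
    (ha1 : a 0 = 1)
    (huniv : Set.InjOn f (Metric.ball (0 : ℂ) 1)) :
    ∀ r : ℝ, 0 ≤ r → r < 1 →
      ∑' k : ℕ, ‖a k‖ * r ^ (2 * k + 1) ≤ r / (1 - r ^ 2) := by
  set h : ℂ → ℂ := fun z => ∑' k, a k * z ^ k with hh
  have hps : PS 1 a h := by
    intro z hz
    obtain ⟨w, rfl, hw⟩ := exists_sq z hz
    refine Summable.hasSum ?_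
    by_cases h0 : w = 0
    · subst h0
      refine summable_of_ne_finset_zero (s := {0}) fun k hk => ?_
      have : k ≠ 0 := by simpa using hk
      simp [this]
    · have := (hf w (by simpa using hw)).summable.mul_left w⁻¹
      refine this.congr fun k => ?_
      rw [pow_succ, pow_mul]; field_simp
  have hfh : ∀ w : ℂ, ‖w‖ < 1 → f w = w * h (w ^ 2) := by
    intro w hw
    have h1 := (hps (w ^ 2) (by rw [norm_pow]; nlinarith [norm_nonneg w])).mul_left w
    refine (hf w (by simpa using hw)).unique ?_
    convert! h1 using 2 with k
    rw [pow_succ, pow_mul]; ring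
  have h00 : h 0 = 1 := by
    have := (hps 0 (by simp)).unique (hasSum_single 0 (by intro k hk; simp [hk]))
    simpa [ha1] using this
  have hne : ∀ z ∈ ball (0:ℂ) 1, h z ≠ 0 := by
    intro z hz hz0
    obtain ⟨w, rfl, hw⟩ := exists_sq z (by simpa using hz)
    have e1 := hfh w hw
    have e2 := hfh 0 (by simp)
    rw [hz0, mul_zero] at e1
    rw [zero_mul] at e2
    have := huniv (by simpa using hw) (show (0:ℂ) ∈ ball (0:ℂ) 1 by simp) (e1.trans e2.symm)
    rw [this] at hz0
    simp [h00] at hz0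
  have hhd := hps.diff one_pos
  obtain ⟨γ, hγ, hexp⟩ := exists_log one_pos hhd hne
  have hinj : InjOn (fun z => z * h z ^ 2) (ball 0 1) := by
    intro z hz z' hz' e
    obtain ⟨w, rfl, hw⟩ := exists_sq z (by simpa using hz)
    obtain ⟨w', rfl, hw'⟩ := exists_sq z' (by simpa using hz')
    have e' : f w ^ 2 = f w' ^ 2 := by
      rw [hfh w hw, hfh w' hw', mul_pow, mul_pow]; exact e
    rcases sq_eq_sq_iff_eq_or_eq_neg.1 e' with h1 | h1
    · rw [huniv (by simpa using hw) (by simpa using hw') h1]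
    · have h2 : f (-w') = - f w' := by
        rw [hfh _ hw', hfh _ (by simpa using hw')]; simp
      rw [← h2] at h1
      rw [huniv (by simpa using hw) (by simpa using hw') h1]; ring
  have hγps := ps_cf hγ
  have hrec : ∀ k : ℕ, (k:ℂ) * a k = ∑ p ∈ Finset.HasAntidiagonal.antidiagonal k, (p.1:ℂ) * cf γ p.1 * a p.2 := by
    have p1 := hps.zderiv one_pos
    have p2 := (hγps.zderiv one_pos).mul hps
    have p3 := p2.congr (g' := fun z => z * deriv h z) (by
      intro z hz
      have hz' : z ∈ ball (0:ℂ) 1 := by simpa using hz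
      have e1 := (hγ.differentiableAt (isOpen_ball.mem_nhds hz')).hasDerivAt.cexp
      have e2 : h =ᶠ[𝓝 z] fun z => exp (γ z) := by
        filter_upwards [isOpen_ball.mem_nhds hz'] with w hw using (hexp w hw).symm
      rw [(e1.congr_of_eventuallyEq e2).deriv, hexp z hz']
      ring)
    exact fun k => congrFun (p1.unique one_pos one_pos p3) k
  have hsq : ∀ (n : ℕ) (x : ℝ), 0 ≤ x → x < 1 → ∑ k ∈ Finset.range n, ‖a k‖ ^ 2 * x ^ k ≤ 1 / (1 - x) := by
    intro n x hx0 hx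
    have h1 := lebedev_milin ha1 hrec n hx0
    have h2 := milin_type hγ hhd hexp hinj n hx0 hx
    have h3 : Real.exp (NN n (cf γ) x) ≤ 1 / (1 - x) := by
      refine (Real.exp_le_exp.2 h2).trans (le_of_eq ?_)
      rw [Real.exp_neg, Real.exp_log (by linarith), one_div]
    refine le_trans ?_ (h1.trans h3)
    exact Finset.sum_le_sum_of_subset_of_nonneg (Finset.range_mono (by omega)) (fun k _ _ => by positivity)
  intro r hr0 hr
  have hx1 : r ^ 2 < 1 := by nlinarith
  refine Real.tsum_le_of_sum_range_le (fun k => by positivity) fun n => ?_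
  have s1 := hsq n (r ^ 2) (by positivity) hx1
  have s2 : ∑ k ∈ Finset.range n, (r ^ 2) ^ k ≤ 1 / (1 - r ^ 2) := by
    have := (summable_geometric_of_lt_one (sq_nonneg r) hx1).sum_le_tsum (Finset.range n) (fun k _ => by positivity)
    rw [tsum_geometric_of_lt_one (sq_nonneg r) hx1] at this
    simpa using this
  calc ∑ k ∈ Finset.range n, ‖a k‖ * r ^ (2 * k + 1)
      ≤ ∑ k ∈ Finset.range n, (r / 2 * (‖a k‖ ^ 2 * (r ^ 2) ^ k) + r / 2 * (r ^ 2) ^ k) := by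
        refine Finset.sum_le_sum fun k _ => ?_
        have h1 : ‖a k‖ ≤ (‖a k‖ ^ 2 + 1) / 2 := by nlinarith [sq_nonneg (‖a k‖ - 1)]
        have h2 : r ^ (2 * k + 1) = (r ^ 2) ^ k * r := by rw [pow_succ, pow_mul]
        rw [h2]
        calc ‖a k‖ * ((r ^ 2) ^ k * r) ≤ ((‖a k‖ ^ 2 + 1) / 2) * ((r ^ 2) ^ k * r) := by gcongr
          _ = _ := by ring
    _ = r / 2 * (∑ k ∈ Finset.range n, ‖a k‖ ^ 2 * (r ^ 2) ^ k) + r / 2 * ∑ k ∈ Finset.range n, (r ^ 2) ^ k := by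
        rw [Finset.sum_add_distrib, Finset.mul_sum, Finset.mul_sum]
    _ ≤ r / 2 * (1 / (1 - r ^ 2)) + r / 2 * (1 / (1 - r ^ 2)) := by gcongr
    _ = _ := by ring

end OddUniv

/-- If `f(z) = ∑_{k≥1} a_{2k-1} z^{2k-1}` is odd and univalent in 𝔻 with `a_1 = 1`, then
`∑_{k≥1} |a_{2k-1}| r^{2k-1} ≤ r/(1-r²)` for all `0 ≤ r < 1`. -/
theorem odd_univalent_majorant_bound (f : ℂ → ℂ) (a : ℕ → ℂ)
    (hf : ∀ z ∈ Metric.ball (0 : ℂ) 1, HasSum (fun k : ℕ => a k * z ^ (2 * k + 1)) (f z))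
    (ha1 : a 0 = 1)
    (huniv : Set.InjOn f (Metric.ball (0 : ℂ) 1)) :
    ∀ r : ℝ, 0 ≤ r → r < 1 →
      ∑' k : ℕ, ‖a k‖ * r ^ (2 * k + 1) ≤ r / (1 - r ^ 2) := by
  exact odd_univalent_majorant_bound' f a hf ha1 huniv
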